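/- arXiv:1611.05467 — 3 statements merged into one kernel-verified Lean document; each statement's English description precedes it below -/
import Mathlib

section
/- For every D ∈ [D̲, D̄], the regions ℛ*(D) and ℛ†(D) are inner bounds to the D-admissible rate region of the successive refinement problem with the common receiver reconstructions constraint: ℛ*(D) ⊆ ℛ†(D) ⊆ ℛ(D). -/
open Finset

namespace CRR

open scoped Classical

variable {Ω α β γ : Type*}

/-- A probability mass function on a finite type, given as a function. -/
def IsPMF [Fintype Ω] (p : Ω → ℝ) : Prop := (∀ ω, 0 ≤ p ω) ∧ ∑ ω, p ω = 1

/-- Pushforward pmf: the pmf of the random variable `X` when the outcome is drawn from `p`. -/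
noncomputable def push [Fintype Ω] (p : Ω → ℝ) (X : Ω → α) (a : α) : ℝ :=
  ∑ ω, if X ω = a then p ω else 0

/-- Shannon entropy (base 2) of a pmf, with the convention 0·log 0 = 0. -/
noncomputable def ent [Fintype α] (q : α → ℝ) : ℝ := -∑ a, q a * Real.logb 2 (q a)

/-- Entropy of a random variable `X` under `p`. -/
noncomputable def entRV [Fintype Ω] [Fintype α] (p : Ω → ℝ) (X : Ω → α) : ℝ := ent (push p X)

/-- Conditional entropy H(X|Y) under `p`. -/
noncomputable def condEntRV [Fintype Ω] [Fintype α] [Fintype β] (p : Ω → ℝ)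
    (X : Ω → α) (Y : Ω → β) : ℝ :=
  entRV p (fun ω => (X ω, Y ω)) - entRV p Y

/-- Conditional mutual information I(X;Y|Z) under `p`. -/
noncomputable def condMI [Fintype Ω] [Fintype α] [Fintype β] [Fintype γ] (p : Ω → ℝ)
    (X : Ω → α) (Y : Ω → β) (Z : Ω → γ) : ℝ :=
  entRV p (fun ω => (X ω, Z ω)) + entRV p (fun ω => (Y ω, Z ω)) -
    entRV p (fun ω => (X ω, Y ω, Z ω)) - entRV p Z

/-- Markov chain X – Y – Z : X and Z are conditionally independent given Y, under `p`. -/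
def MarkovChain [Fintype Ω] (p : Ω → ℝ) (X : Ω → α) (Y : Ω → β) (Z : Ω → γ) : Prop :=
  ∀ x y z, push p (fun ω => (X ω, Y ω, Z ω)) (x, y, z) * push p Y y =
    push p (fun ω => (X ω, Y ω)) (x, y) * push p (fun ω => (Z ω, Y ω)) (z, y)

/-- One step between right nodes of the bipartite graph G^{X,Y}: they share a left neighbour. -/
def GKStep (p : α × β → ℝ) (y₁ y₂ : β) : Prop := ∃ x, 0 < p (x, y₁) ∧ 0 < p (x, y₂)

/-- y₁ ⇌ y₂ : y₁ and y₂ lie in the same connected component of G^{X,Y}. -/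
def GKConn (p : α × β → ℝ) : β → β → Prop := Relation.ReflTransGen (GKStep p)

/-- `g` is a Gács–Körner mapping for the joint pmf `p`. -/
def IsGKMap (p : α × β → ℝ) (g : β → β) : Prop := ∀ y₁ y₂, (g y₁ = g y₂ ↔ GKConn p y₁ y₂)

/-- Expectation of `f` under pmf `p`. -/
noncomputable def expVal [Fintype Ω] (p : Ω → ℝ) (f : Ω → ℝ) : ℝ := ∑ ω, p ω * f ω

section RateRegions

variable {S U V W : Type*} [Fintype S] [Fintype U] [Fintype V] [Fintype W]

/-- The class 𝒫*_{D,k}: joint pmfs q on (Fin k) × S × U × V (auxiliary alphabet of size k)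
with the required marginal, Markov chain A – S – (U,V), and a reconstruction function of the
Gács–Körner common randomness GK^{AU,AV} meeting distortion D. -/
def PStar (p : S × U × V → ℝ) (d : S → W → ℝ) (D : ℝ) (k : ℕ)
    (q : Fin k × S × U × V → ℝ) : Prop :=
  IsPMF q ∧ (∀ y, push q (fun x => x.2) y = p y) ∧
    MarkovChain q (fun x => x.1) (fun x => x.2.1) (fun x => x.2.2) ∧
    ∃ (g : Fin k × V → Fin k × V) (f : Fin k × V → W),
      IsGKMap (push q (fun x => ((x.1, x.2.2.1), (x.1, x.2.2.2)))) g ∧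
      expVal q (fun x => d x.2.1 (f (g (x.1, x.2.2.2)))) ≤ D

/-- The rate region ℛ*_k(D). -/
def RStar (p : S × U × V → ℝ) (d : S → W → ℝ) (D : ℝ) (k : ℕ) : Set (ℝ × ℝ) :=
  {r : ℝ × ℝ | 0 ≤ r.1 ∧ 0 ≤ r.2 ∧ ∃ q : Fin k × S × U × V → ℝ, PStar p d D k q ∧
    condMI q (fun x => x.2.1) (fun x => x.1) (fun x => x.2.2.1) ≤ r.1 ∧
    condMI q (fun x => x.2.1) (fun x => x.1) (fun x => x.2.2.2) ≤ r.2 + r.1}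

/-- The class 𝒫‡_{D,k}: joint pmfs q on (Fin k × Fin k × Fin k) × S × U × V
(coordinates (A,B,C,S,U,V)) with marginal p, Markov chain (A,B,C) – S – (U,V) and a
reconstruction function of GK^{ABU,ACV} meeting distortion D. -/
def PDdag (p : S × U × V → ℝ) (d : S → W → ℝ) (D : ℝ) (k : ℕ)
    (q : (Fin k × Fin k × Fin k) × S × U × V → ℝ) : Prop :=
  IsPMF q ∧ (∀ y, push q (fun x => x.2) y = p y) ∧
    MarkovChain q (fun x => x.1) (fun x => x.2.1) (fun x => x.2.2) ∧
    ∃ (g : Fin k × Fin k × V → Fin k × Fin k × V) (f : Fin k × Fin k × V → W),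
      IsGKMap (push q (fun x => ((x.1.1, x.1.2.1, x.2.2.1), (x.1.1, x.1.2.2, x.2.2.2)))) g ∧
      expVal q (fun x => d x.2.1 (f (g (x.1.1, x.1.2.2, x.2.2.2)))) ≤ D

/-- The rate region ℛ‡_k(D). -/
def RDdag (p : S × U × V → ℝ) (d : S → W → ℝ) (D : ℝ) (k : ℕ) : Set (ℝ × ℝ) :=
  {r : ℝ × ℝ | 0 ≤ r.1 ∧ 0 ≤ r.2 ∧
    ∃ q : (Fin k × Fin k × Fin k) × S × U × V → ℝ, PDdag p d D k q ∧
    condMI q (fun x => x.2.1) (fun x => (x.1.1, x.1.2.1)) (fun x => x.2.2.1) ≤ r.1 ∧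
    condMI q (fun x => x.2.1) (fun x => x.1.2.1) (fun x => (x.1.1, x.1.2.2, x.2.2)) +
      condMI q (fun x => x.2.1) (fun x => (x.1.1, x.1.2.2)) (fun x => x.2.2.2) ≤ r.2 + r.1}

/-- The class 𝒫†_{D,k}: members of 𝒫‡_{D,k} with additionally B – (A,S) – C. -/
def PDag (p : S × U × V → ℝ) (d : S → W → ℝ) (D : ℝ) (k : ℕ)
    (q : (Fin k × Fin k × Fin k) × S × U × V → ℝ) : Prop :=
  PDdag p d D k q ∧
    MarkovChain q (fun x => x.1.2.1) (fun x => (x.1.1, x.2.1)) (fun x => x.1.2.2)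

/-- The rate region ℛ†_k(D). -/
def RDag (p : S × U × V → ℝ) (d : S → W → ℝ) (D : ℝ) (k : ℕ) : Set (ℝ × ℝ) :=
  {r : ℝ × ℝ | 0 ≤ r.1 ∧ 0 ≤ r.2 ∧
    ∃ q : (Fin k × Fin k × Fin k) × S × U × V → ℝ, PDag p d D k q ∧
    condMI q (fun x => x.2.1) (fun x => (x.1.1, x.1.2.1)) (fun x => x.2.2.1) ≤ r.1 ∧
    max (condMI q (fun x => x.2.1) (fun x => x.1.1) (fun x => x.2.2.1))
        (condMI q (fun x => x.2.1) (fun x => x.1.1) (fun x => x.2.2.2)) +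
      condMI q (fun x => x.2.1) (fun x => x.1.2.1) (fun x => (x.1.1, x.2.2.1)) +
      condMI q (fun x => x.2.1) (fun x => x.1.2.2) (fun x => (x.1.1, x.2.2.2)) ≤ r.2 + r.1}

end RateRegions

section Admissibility

variable {S U V W : Type*} [Fintype S] [Fintype U] [Fintype V] [Fintype W]

/-- The i.i.d. product pmf of n copies of p. -/
noncomputable def iidPMF (p : S × U × V → ℝ) (n : ℕ) : (Fin n → S × U × V) → ℝ :=
  fun ω => ∏ i, p (ω i)

/-- The rate pair (r.1, r.2) = (r_uv, r_v) is D-admissible for the successive refinement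
problem with receiver side information and common receiver reconstructions. -/
def Admissible (p : S × U × V → ℝ) (d : S → W → ℝ) (D : ℝ) (r : ℝ × ℝ) : Prop :=
  0 ≤ r.1 ∧ 0 ≤ r.2 ∧
  ∀ ε : ℝ, 0 < ε → ∃ n : ℕ, 0 < n ∧
    ∃ (Euv : (Fin n → S) → Fin ⌈(2 : ℝ) ^ ((n : ℝ) * (r.1 + ε))⌉₊)
      (Ev : (Fin n → S) → Fin ⌈(2 : ℝ) ^ ((n : ℝ) * (r.2 + ε))⌉₊)
      (Du : Fin ⌈(2 : ℝ) ^ ((n : ℝ) * (r.1 + ε))⌉₊ → (Fin n → U) → Fin n → W)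
      (Dv : Fin ⌈(2 : ℝ) ^ ((n : ℝ) * (r.1 + ε))⌉₊ → Fin ⌈(2 : ℝ) ^ ((n : ℝ) * (r.2 + ε))⌉₊ →
        (Fin n → V) → Fin n → W),
      (fun (Shat Stil : (Fin n → S × U × V) → Fin n → W) =>
        (1 / (n : ℝ)) * ∑ i, expVal (iidPMF p n) (fun ω => d ((ω i).1) (Shat ω i)) ≤ D + ε ∧
        (1 / (n : ℝ)) * ∑ i, expVal (iidPMF p n) (fun ω => d ((ω i).1) (Stil ω i)) ≤ D + ε ∧
        ∑ ω, (if Shat ω ≠ Stil ω then iidPMF p n ω else 0) ≤ ε)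
      (fun ω => Du (Euv (fun j => (ω j).1)) (fun j => (ω j).2.1))
      (fun ω => Dv (Euv (fun j => (ω j).1)) (Ev (fun j => (ω j).1)) (fun j => (ω j).2.2))

end Admissibility

/-- The probability of an event under `P`. -/
noncomputable def prob [Fintype Ω] (P : Ω → ℝ) (E : Ω → Prop) : ℝ :=
  ∑ ω, if E ω then P ω else 0

/-- The product pmf with identical factors, over an arbitrary finite index type. -/
noncomputable def iid {ι : Type*} [Fintype ι] (q : Ω → ℝ) (ω : ι → Ω) : ℝ := ∏ i, q (ω i)

section Basic

variable [Fintype Ω] {P : Ω → ℝ}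

lemma prob_mono (hP : ∀ ω, 0 ≤ P ω) {E F : Ω → Prop} (h : ∀ ω, 0 < P ω → E ω → F ω) :
    prob P E ≤ prob P F := by
  refine Finset.sum_le_sum fun ω _ => ?_
  rcases (hP ω).eq_or_lt with h0 | h0
  · simp [← h0]
  · by_cases hE : E ω
    · simp [hE, h ω h0 hE]
    · by_cases hF : F ω <;> simp [hE, hF, h0.le]

lemma prob_or_le (hP : ∀ ω, 0 ≤ P ω) (E F : Ω → Prop) :
    prob P (fun ω => E ω ∨ F ω) ≤ prob P E + prob P F := by
  unfold prob
  rw [← Finset.sum_add_distrib]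
  refine Finset.sum_le_sum fun ω _ => ?_
  have := hP ω
  by_cases hE : E ω <;> by_cases hF : F ω <;> simp [hE, hF, this]

lemma prob_nonneg (hP : ∀ ω, 0 ≤ P ω) (E : Ω → Prop) : 0 ≤ prob P E :=
  Finset.sum_nonneg fun ω _ => by split_ifs <;> simp [hP ω]

lemma push_nonneg (hP : ∀ ω, 0 ≤ P ω) (X : Ω → α) (a : α) : 0 ≤ push P X a :=
  Finset.sum_nonneg fun ω _ => by split_ifs <;> simp [hP ω]

lemma push_pos (hP : ∀ ω, 0 ≤ P ω) (X : Ω → α) {ω : Ω} (h : 0 < P ω) : 0 < push P X (X ω) := by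
  refine Finset.sum_pos' (fun ω _ => by split_ifs <;> simp [hP ω]) ⟨ω, Finset.mem_univ _, ?_⟩
  simpa using h

lemma push_le_push (hP : ∀ ω, 0 ≤ P ω) (X : Ω → α) (Y : Ω → β) (a : α) (b : β)
    (h : ∀ ω, X ω = a → Y ω = b) : push P X a ≤ push P Y b :=
  prob_mono hP (E := fun ω => X ω = a) (F := fun ω => Y ω = b) fun ω _ => h ω

lemma sum_push_mul [Fintype α] (X : Ω → α) (g : α → ℝ) :
    ∑ a, push P X a * g a = ∑ ω, P ω * g (X ω) := by
  unfold push
  simp_rw [Finset.sum_mul]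
  rw [Finset.sum_comm]
  refine Finset.sum_congr rfl fun ω _ => ?_
  simp [ite_mul]

lemma push_comp [Fintype α] (X : Ω → α) (g : α → β) :
    push (push P X) g = push P (fun ω => g (X ω)) := by
  funext b
  have := sum_push_mul (P := P) X (fun a => if g a = b then 1 else 0)
  simpa [push] using this

lemma sum_push_pair [Fintype α] (X : Ω → α) (Y : Ω → β) (y : β) :
    ∑ x, push P (fun ω => (X ω, Y ω)) (x, y) = push P Y y := by
  unfold push
  rw [Finset.sum_comm]
  refine Finset.sum_congr rfl fun ω _ => ?_
  by_cases h : Y ω = y <;> simp [Prod.ext_iff, h]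

lemma push_injective_comp (X : Ω → α) {e : α → β} (he : Function.Injective e) (a : α) :
    push P (fun ω => e (X ω)) (e a) = push P X a := by
  unfold push
  simp [he.eq_iff]

lemma push_pair_apply [Fintype α] (X : Ω → α) (Y : Ω → β) (g : α → γ) (c : γ) (y : β) :
    push P (fun ω => (g (X ω), Y ω)) (c, y)
      = ∑ x, push P (fun ω => (X ω, Y ω)) (x, y) * (if g x = c then 1 else 0) := by
  unfold push
  simp_rw [Finset.sum_mul]
  rw [Finset.sum_comm]
  refine Finset.sum_congr rfl fun ω _ => ?_
  rw [Finset.sum_eq_single (X ω)]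
  · by_cases h : Y ω = y <;> simp [Prod.ext_iff, h]
  · intro b _ hb
    simp [Prod.ext_iff, hb.symm]
  · simp

lemma isPMF_push [Fintype α] (hP : IsPMF P) (X : Ω → α) : IsPMF (push P X) := by
  refine ⟨push_nonneg hP.1 X, ?_⟩
  have := sum_push_mul (P := P) X (fun _ => 1)
  simpa [hP.2] using this

lemma exists_le_of_expVal_le (hP : IsPMF P) {f : Ω → ℝ} {c : ℝ} (h : ∑ ω, P ω * f ω ≤ c) :
    ∃ ω, f ω ≤ c := by
  by_contra! hc
  have hne : ∃ ω, 0 < P ω := by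
    by_contra! h0
    have : ∑ ω, P ω ≤ 0 := Finset.sum_nonpos fun ω _ => h0 ω
    linarith [hP.2]
  obtain ⟨ω₀, h0⟩ := hne
  have : ∑ ω, P ω * c < ∑ ω, P ω * f ω :=
    Finset.sum_lt_sum (fun ω _ => mul_le_mul_of_nonneg_left (hc ω).le (hP.1 ω))
      ⟨ω₀, Finset.mem_univ _, mul_lt_mul_of_pos_left (hc ω₀) h0⟩
  rw [← Finset.sum_mul, hP.2] at this
  linarith

end Basic

section Product

variable {ι : Type*} [Fintype ι] {q : Ω → ℝ}

lemma iid_nonneg (hq : ∀ ω, 0 ≤ q ω) (ω : ι → Ω) : 0 ≤ iid q ω :=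
  Finset.prod_nonneg fun _ _ => hq _

lemma pos_of_iid_pos (hq : ∀ ω, 0 ≤ q ω) {ω : ι → Ω} (h : 0 < iid q ω) (i : ι) : 0 < q (ω i) := by
  refine (hq _).lt_of_ne fun h0 => h.ne' ?_
  exact Finset.prod_eq_zero (Finset.mem_univ i) h0.symm

variable [DecidableEq ι] [Fintype Ω]

lemma sum_iid_mul_prod (q : Ω → ℝ) (g : ι → Ω → ℝ) :
    ∑ ω : ι → Ω, iid q ω * ∏ i, g i (ω i) = ∏ i, ∑ k, q k * g i k := by
  rw [Finset.prod_univ_sum]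
  simp [iid, Finset.prod_mul_distrib]

lemma isPMF_iid (hq : IsPMF q) : IsPMF (iid q : (ι → Ω) → ℝ) := by
  refine ⟨iid_nonneg hq.1, ?_⟩
  have := sum_iid_mul_prod (ι := ι) q (fun _ _ => 1)
  simpa [hq.2] using this

lemma sum_iid_mul_apply (hq : IsPMF q) (i : ι) (u : Ω → ℝ) :
    ∑ ω : ι → Ω, iid q ω * u (ω i) = ∑ k, q k * u k := by
  have := sum_iid_mul_prod (ι := ι) q (fun l k => if l = i then u k else 1)
  rw [Finset.prod_eq_single i] at this
  · rw [← (by simp : ∑ k, q k * (if i = i then u k else 1) = ∑ k, q k * u k), ← this]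
    refine Finset.sum_congr rfl fun ω _ => ?_
    simp
  · intro l _ hl
    simp [hl, hq.2]
  · simp

lemma sum_iid_mul_apply_mul_apply (hq : IsPMF q) {i j : ι} (hij : i ≠ j) (u v : Ω → ℝ) :
    ∑ ω : ι → Ω, iid q ω * (u (ω i) * v (ω j)) = (∑ k, q k * u k) * ∑ k, q k * v k := by
  have := sum_iid_mul_prod (ι := ι) q
    (fun l k => (if l = i then u k else 1) * (if l = j then v k else 1))
  rw [← Finset.prod_subset (Finset.subset_univ {i, j}), Finset.prod_pair hij] at this
  · simp only [if_true, if_neg hij, if_neg hij.symm, mul_one, one_mul] at this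
    rw [← this]
    refine Finset.sum_congr rfl fun ω _ => ?_
    rw [Finset.prod_mul_distrib]
    simp
  · intro l _ hl
    simp only [Finset.mem_insert, Finset.mem_singleton, not_or] at hl
    simp [hl.1, hl.2, hq.2]

lemma sum_iid_mul_sq (hq : IsPMF q) (c : ι → ℝ) (u : Ω → ℝ) (hu : ∑ k, q k * u k = 0) :
    ∑ ω : ι → Ω, iid q ω * (∑ i, c i * u (ω i)) ^ 2
      = (∑ i, c i ^ 2) * ∑ k, q k * u k ^ 2 := by
  have h1 : ∀ ω : ι → Ω, iid q ω * (∑ i, c i * u (ω i)) ^ 2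
      = ∑ i, ∑ j, c i * c j * (iid q ω * (u (ω i) * u (ω j))) := by
    intro ω
    rw [sq, Finset.sum_mul_sum, Finset.mul_sum]
    refine Finset.sum_congr rfl fun i _ => ?_
    rw [Finset.mul_sum]
    exact Finset.sum_congr rfl fun j _ => by ring
  simp_rw [h1]
  rw [Finset.sum_comm, Finset.sum_mul]
  refine Finset.sum_congr rfl fun i _ => ?_
  rw [Finset.sum_comm, Finset.sum_eq_single i]
  · rw [← Finset.mul_sum, ← sum_iid_mul_apply hq i (fun k => u k ^ 2), sq]
    simp_rw [sq]
  · intro j _ hj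
    rw [← Finset.mul_sum, sum_iid_mul_apply_mul_apply hq hj.symm, hu]
    simp
  · simp

lemma push_iid [Fintype α] (Z : Ω → α) (z : ι → α) :
    push (iid q) (fun ω i => Z (ω i)) z = ∏ i, push q Z (z i) := by
  have := sum_iid_mul_prod (ι := ι) q (fun i k => if Z k = z i then 1 else 0)
  simp only [mul_ite, mul_one, mul_zero] at this
  unfold push
  rw [← this]
  refine Finset.sum_congr rfl fun ω _ => ?_
  by_cases h : ∀ i, Z (ω i) = z i
  · simp [h]
  · rw [if_neg (fun h' => h fun i => congrFun h' i)]
    push Not at h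
    obtain ⟨i, hi⟩ := h
    rw [Finset.prod_eq_zero (Finset.mem_univ i) (by simp [hi])]
    simp

lemma push_iid_pair [Fintype α] [Fintype β] (X : Ω → α) (Y : Ω → β) (x : ι → α) (y : ι → β) :
    push (iid q) (fun ω => ((fun i => X (ω i)), fun i => Y (ω i))) (x, y)
      = ∏ i, push q (fun ω => (X ω, Y ω)) (x i, y i) := by
  rw [← push_iid (fun ω => (X ω, Y ω)) (fun i => (x i, y i))]
  exact (push_injective_comp (fun ω : ι → Ω => ((fun i => X (ω i)), fun i => Y (ω i)))
    (Equiv.arrowProdEquivProdArrow ι (fun _ => α) (fun _ => β)).symm.injective (x, y)).symm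

end Product

/-- Weak law of large numbers, in the form of Chebyshev's inequality. -/
lemma prob_iid_deviation_le [Fintype Ω] {q : Ω → ℝ} (hq : IsPMF q) (g : Ω → ℝ) {δ η : ℝ}
    (hδ : 0 < δ) (hη : 0 < η) : ∃ N : ℕ, ∀ n ≥ N,
      prob (iid q) (fun ω : Fin n → Ω => δ * n ≤ |∑ i, g (ω i) - n * expVal q g|) ≤ η := by
  set μ := expVal q g with hμ
  set σ := ∑ k, q k * (g k - μ) ^ 2 with hσ
  have hσ0 : 0 ≤ σ := Finset.sum_nonneg fun k _ => mul_nonneg (hq.1 k) (sq_nonneg _)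
  have hmean : ∑ k, q k * (g k - μ) = 0 := by
    simp_rw [mul_sub, Finset.sum_sub_distrib, ← Finset.sum_mul, hq.2]
    simp [hμ, expVal]
  refine ⟨⌈σ / (δ ^ 2 * η)⌉₊ + 1, fun n hn => ?_⟩
  have hn0 : (0 : ℝ) < n := by exact_mod_cast (by omega : 0 < n)
  have hn1 : σ / (δ ^ 2 * η) ≤ n := (Nat.le_ceil _).trans (by exact_mod_cast (by omega))
  have key := sum_iid_mul_sq (ι := Fin n) hq (fun _ => 1) (fun k => g k - μ) hmean
  have hle : prob (iid q) (fun ω : Fin n → Ω => δ * n ≤ |∑ i, g (ω i) - n * μ|) * (δ * n) ^ 2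
      ≤ n * σ := by
    have : (n : ℝ) * σ = ∑ ω : Fin n → Ω, iid q ω * (∑ i, 1 * (g (ω i) - μ)) ^ 2 := by
      rw [key]; simp [hσ]
    rw [this, prob, Finset.sum_mul]
    refine Finset.sum_le_sum fun ω _ => ?_
    have h0 := iid_nonneg (ι := Fin n) hq.1 ω
    have h1 : ∑ i, 1 * (g (ω i) - μ) = ∑ i, g (ω i) - n * μ := by simp
    rw [h1]
    split_ifs with h
    · refine mul_le_mul_of_nonneg_left ?_ h0
      rw [← sq_abs (∑ i, g (ω i) - n * μ)]
      exact pow_le_pow_left₀ (by positivity) h 2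
    · rw [zero_mul]; positivity
  have h2 : σ ≤ n * (δ ^ 2 * η) := by rwa [div_le_iff₀ (by positivity)] at hn1
  have h3 : n * σ ≤ η * (δ * n) ^ 2 := by nlinarith
  exact le_of_mul_le_mul_right (hle.trans h3) (by positivity)

section Information

variable [Fintype Ω] [Fintype α] [Fintype β] [Fintype γ] {P : Ω → ℝ}

lemma entRV_eq_sum (P : Ω → ℝ) (X : Ω → α) :
    entRV P X = -∑ ω, P ω * Real.logb 2 (push P X (X ω)) := by
  rw [entRV, ent, sum_push_mul X (fun a => Real.logb 2 (push P X a))]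

lemma entRV_injective_comp (P : Ω → ℝ) (X : Ω → α) {e : α → β}
    (he : Function.Injective e) : entRV P (fun ω => e (X ω)) = entRV P X := by
  rw [entRV_eq_sum, entRV_eq_sum]
  simp_rw [push_injective_comp X he]

lemma condEntRV_eq_expVal (hP : ∀ ω, 0 ≤ P ω) (X : Ω → α) (Y : Ω → β) :
    condEntRV P X Y = expVal P (fun ω =>
      -Real.logb 2 (push P (fun ω => (X ω, Y ω)) (X ω, Y ω) / push P Y (Y ω))) := by
  rw [condEntRV, entRV_eq_sum, entRV_eq_sum, expVal, ← Finset.sum_neg_distrib,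
    ← Finset.sum_neg_distrib, ← Finset.sum_sub_distrib]
  refine Finset.sum_congr rfl fun ω _ => ?_
  rcases (hP ω).eq_or_lt with h0 | h0
  · simp [← h0]
  · rw [Real.logb_div (push_pos hP (fun ω => (X ω, Y ω)) h0).ne' (push_pos hP Y h0).ne']
    ring

lemma condEntRV_nonneg (hP : ∀ ω, 0 ≤ P ω) (X : Ω → α) (Y : Ω → β) :
    0 ≤ condEntRV P X Y := by
  rw [condEntRV_eq_expVal hP]
  refine Finset.sum_nonneg fun ω _ => ?_
  rcases (hP ω).eq_or_lt with h0 | h0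
  · simp [← h0]
  · have h1 := push_pos hP (fun ω => (X ω, Y ω)) h0
    have h2 := push_pos hP Y h0
    refine mul_nonneg h0.le (neg_nonneg.2 (Real.logb_nonpos one_lt_two (by positivity) ?_))
    rw [div_le_one h2]
    exact push_le_push hP _ _ _ _ fun ω' h => (Prod.ext_iff.1 h).2

lemma condMI_nonneg (hP : IsPMF P) (X : Ω → α) (Y : Ω → β) (Z : Ω → γ) :
    0 ≤ condMI P X Y Z := by
  set xz := push P (fun ω => (X ω, Z ω)) with hxz
  set yz := push P (fun ω => (Y ω, Z ω)) with hyz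
  set xyz := push P (fun ω => (X ω, Y ω, Z ω)) with hxyz
  set z := push P Z with hz
  have hxz0 : ∀ a, 0 ≤ xz a := push_nonneg hP.1 _
  have hyz0 : ∀ a, 0 ≤ yz a := push_nonneg hP.1 _
  have hxyz0 : ∀ a, 0 ≤ xyz a := push_nonneg hP.1 _
  have hz0 : ∀ a, 0 ≤ z a := push_nonneg hP.1 _
  have hratio : ∑ ω, P ω * (xz (X ω, Z ω) * yz (Y ω, Z ω) / (xyz (X ω, Y ω, Z ω) * z (Z ω)))
      ≤ 1 := by
    have h1 := sum_push_mul (P := P) (fun ω => (X ω, Y ω, Z ω))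
      (fun t => xz (t.1, t.2.2) * yz (t.2.1, t.2.2) / (xyz t * z t.2.2))
    rw [← h1]
    have h2 : ∀ t : α × β × γ, xyz t * (xz (t.1, t.2.2) * yz (t.2.1, t.2.2) / (xyz t * z t.2.2))
        ≤ xz (t.1, t.2.2) * yz (t.2.1, t.2.2) / z t.2.2 := by
      intro t
      rcases (hxyz0 t).eq_or_lt with h0 | h0
      · rw [← h0, zero_mul]
        exact div_nonneg (mul_nonneg (hxz0 _) (hyz0 _)) (hz0 _)
      · rw [mul_comm (xyz t) (z t.2.2), ← div_div, mul_div_cancel₀ _ h0.ne']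
    refine (Finset.sum_le_sum fun t _ => h2 t).trans ?_
    rw [Fintype.sum_prod_type]
    simp_rw [Fintype.sum_prod_type]
    have h3 : ∑ x : α, ∑ y : β, ∑ c : γ, xz (x, c) * yz (y, c) / z c
        = ∑ c, (∑ x, xz (x, c)) * (∑ y, yz (y, c)) / z c := by
      calc _ = ∑ x : α, ∑ c : γ, ∑ y : β, xz (x, c) * yz (y, c) / z c :=
            Finset.sum_congr rfl fun x _ => Finset.sum_comm
        _ = ∑ c : γ, ∑ x : α, ∑ y : β, xz (x, c) * yz (y, c) / z c := Finset.sum_comm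
        _ = _ := by
            refine Finset.sum_congr rfl fun c _ => ?_
            rw [Finset.sum_mul_sum, Finset.sum_div]
            exact Finset.sum_congr rfl fun x _ => by rw [Finset.sum_div]
    rw [h3, hxz, hyz]
    simp_rw [sum_push_pair]
    rw [← (isPMF_push hP Z).2]
    refine Finset.sum_le_sum fun c _ => ?_
    rw [mul_self_div_self]
  have hlog : condMI P X Y Z = ∑ ω, P ω * -Real.logb 2
      (xz (X ω, Z ω) * yz (Y ω, Z ω) / (xyz (X ω, Y ω, Z ω) * z (Z ω))) := by
    rw [condMI, entRV_eq_sum, entRV_eq_sum, entRV_eq_sum, entRV_eq_sum,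
      ← Finset.sum_neg_distrib, ← Finset.sum_neg_distrib, ← Finset.sum_neg_distrib,
      ← Finset.sum_neg_distrib, ← Finset.sum_add_distrib, ← Finset.sum_sub_distrib,
      ← Finset.sum_sub_distrib]
    refine Finset.sum_congr rfl fun ω _ => ?_
    rcases (hP.1 ω).eq_or_lt with h0 | h0
    · simp [← h0]
    · have a1 : xz (X ω, Z ω) ≠ 0 := (push_pos hP.1 (fun ω => (X ω, Z ω)) h0).ne'
      have a2 : yz (Y ω, Z ω) ≠ 0 := (push_pos hP.1 (fun ω => (Y ω, Z ω)) h0).ne'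
      have a3 : xyz (X ω, Y ω, Z ω) ≠ 0 := (push_pos hP.1 (fun ω => (X ω, Y ω, Z ω)) h0).ne'
      have a4 : z (Z ω) ≠ 0 := (push_pos hP.1 Z h0).ne'
      rw [Real.logb_div (mul_ne_zero a1 a2) (mul_ne_zero a3 a4), Real.logb_mul a1 a2,
        Real.logb_mul a3 a4]
      ring
  have hl2 : 0 < Real.log 2 := Real.log_pos one_lt_two
  have hterm : ∀ ω, P ω * ((1 - xz (X ω, Z ω) * yz (Y ω, Z ω) /
      (xyz (X ω, Y ω, Z ω) * z (Z ω))) / Real.log 2) ≤ P ω * -Real.logb 2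
      (xz (X ω, Z ω) * yz (Y ω, Z ω) / (xyz (X ω, Y ω, Z ω) * z (Z ω))) := by
    intro ω
    rcases (hP.1 ω).eq_or_lt with h0 | h0
    · simp [← h0]
    · have a1 : 0 < xz (X ω, Z ω) := push_pos hP.1 (fun ω => (X ω, Z ω)) h0
      have a2 : 0 < yz (Y ω, Z ω) := push_pos hP.1 (fun ω => (Y ω, Z ω)) h0
      have a3 : 0 < xyz (X ω, Y ω, Z ω) := push_pos hP.1 (fun ω => (X ω, Y ω, Z ω)) h0
      have a4 : 0 < z (Z ω) := push_pos hP.1 Z h0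
      refine mul_le_mul_of_nonneg_left ?_ h0.le
      rw [Real.logb, ← neg_div]
      refine div_le_div_of_nonneg_right ?_ hl2.le
      have := Real.log_le_sub_one_of_pos
        (show 0 < xz (X ω, Z ω) * yz (Y ω, Z ω) / (xyz (X ω, Y ω, Z ω) * z (Z ω)) by positivity)
      linarith
  rw [hlog]
  refine le_trans ?_ (Finset.sum_le_sum fun ω _ => hterm ω)
  have : ∑ ω, P ω * ((1 - xz (X ω, Z ω) * yz (Y ω, Z ω) /
      (xyz (X ω, Y ω, Z ω) * z (Z ω))) / Real.log 2) = (1 - ∑ ω, P ω * (xz (X ω, Z ω) *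
      yz (Y ω, Z ω) / (xyz (X ω, Y ω, Z ω) * z (Z ω)))) / Real.log 2 := by
    rw [eq_div_iff hl2.ne', Finset.sum_mul, eq_sub_iff_add_eq, ← Finset.sum_add_distrib]
    refine (Finset.sum_congr rfl fun ω _ => ?_).trans hP.2
    rw [mul_assoc, div_mul_cancel₀ _ hl2.ne']
    ring
  rw [this]
  exact div_nonneg (by linarith) hl2.le

lemma MarkovChain.entRV_add {X : Ω → α} {Y : Ω → β} {Z : Ω → γ} (hP : ∀ ω, 0 ≤ P ω)
    (h : MarkovChain P X Y Z) :
    entRV P (fun ω => (X ω, Y ω, Z ω)) + entRV P Y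
      = entRV P (fun ω => (X ω, Y ω)) + entRV P (fun ω => (Z ω, Y ω)) := by
  rw [entRV_eq_sum, entRV_eq_sum, entRV_eq_sum, entRV_eq_sum, ← neg_add, ← neg_add,
    ← Finset.sum_add_distrib, ← Finset.sum_add_distrib]
  congr 1
  refine Finset.sum_congr rfl fun ω _ => ?_
  rcases (hP ω).eq_or_lt with h0 | h0
  · simp [← h0]
  · have a1 := (push_pos hP (fun ω => (X ω, Y ω, Z ω)) h0).ne'
    have a2 := (push_pos hP Y h0).ne'
    have a3 := (push_pos hP (fun ω => (X ω, Y ω)) h0).ne'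
    have a4 := (push_pos hP (fun ω => (Z ω, Y ω)) h0).ne'
    rw [← mul_add, ← mul_add, ← Real.logb_mul a1 a2, ← Real.logb_mul a3 a4, h]

lemma MarkovChain.comp {α' γ' : Type*} {X : Ω → α} {Y : Ω → β} {Z : Ω → γ}
    (h : MarkovChain P X Y Z) (f : α → α') (g : γ → γ') :
    MarkovChain P (fun ω => f (X ω)) Y (fun ω => g (Z ω)) := by
  intro x' y z'
  have e1 : push P (fun ω => (f (X ω), Y ω, g (Z ω))) (x', y, z') =
      ∑ x, ∑ z, push P (fun ω => (X ω, Y ω, Z ω)) (x, y, z) *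
        ((if f x = x' then 1 else 0) * (if g z = z' then 1 else 0)) := by
    rw [push_pair_apply X (fun ω => (Y ω, g (Z ω))) f]
    refine Finset.sum_congr rfl fun x _ => ?_
    have := push_pair_apply (P := P) Z (fun ω => (X ω, Y ω)) g z' (x, y)
    rw [← push_injective_comp (fun ω => (X ω, Y ω, g (Z ω)))
      (e := fun t => (t.2.2, t.1, t.2.1)) (fun a b hab => by grind) (x, y, z'), this,
      Finset.sum_mul]
    refine Finset.sum_congr rfl fun z _ => ?_
    rw [← push_injective_comp (fun ω => (X ω, Y ω, Z ω))
      (e := fun t => (t.2.2, t.1, t.2.1)) (fun a b hab => by grind) (x, y, z)]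
    ring
  rw [e1, push_pair_apply X Y f, push_pair_apply Z Y g, Finset.sum_mul_sum, Finset.sum_mul]
  refine Finset.sum_congr rfl fun x _ => ?_
  rw [Finset.sum_mul]
  refine Finset.sum_congr rfl fun z _ => ?_
  linear_combination ((if f x = x' then 1 else 0) * (if g z = z' then 1 else 0)) * h x y z

end Information

/-- Asymptotic equipartition for conditional probabilities. -/
lemma exists_conditional_aep [Fintype Ω] [Fintype α] [Fintype β] {q : Ω → ℝ} (hq : IsPMF q)
    (X : Ω → α) (Y : Ω → β) {δ η : ℝ} (hδ : 0 < δ) (hη : 0 < η) : ∃ N : ℕ, ∀ n ≥ N,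
      prob (iid q) (fun ω : Fin n → Ω =>
        ¬ (push (iid q) (fun ω : Fin n → Ω => ((fun i => X (ω i)), fun i => Y (ω i)))
            ((fun i => X (ω i)), fun i => Y (ω i))
          ≤ (2 : ℝ) ^ (-(n * (condEntRV q X Y - δ))) *
            push (iid q) (fun (ω : Fin n → Ω) i => Y (ω i)) (fun i => Y (ω i)))) ≤ η ∧
      prob (iid q) (fun ω : Fin n → Ω =>
        ¬ ((2 : ℝ) ^ (-(n * (condEntRV q X Y + δ))) *
            push (iid q) (fun (ω : Fin n → Ω) i => Y (ω i)) (fun i => Y (ω i))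
          ≤ push (iid q) (fun ω : Fin n → Ω => ((fun i => X (ω i)), fun i => Y (ω i)))
            ((fun i => X (ω i)), fun i => Y (ω i)))) ≤ η := by
  set g : Ω → ℝ := fun ω =>
    -Real.logb 2 (push q (fun ω => (X ω, Y ω)) (X ω, Y ω) / push q Y (Y ω)) with hg
  obtain ⟨N, hN⟩ := prob_iid_deviation_le hq g hδ hη
  rw [condEntRV_eq_expVal hq.1, ← hg]
  have key : ∀ n : ℕ, ∀ ω : Fin n → Ω, 0 < iid q ω →
      push (iid q) (fun ω : Fin n → Ω => ((fun i => X (ω i)), fun i => Y (ω i)))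
            ((fun i => X (ω i)), fun i => Y (ω i)) = (2 : ℝ) ^ (-∑ i, g (ω i)) *
          push (iid q) (fun (ω : Fin n → Ω) i => Y (ω i)) (fun i => Y (ω i)) := by
    intro n ω hω
    rw [push_iid_pair, push_iid, ← Finset.sum_neg_distrib,
      Real.rpow_sum_of_pos (by norm_num), ← Finset.prod_mul_distrib]
    refine Finset.prod_congr rfl fun i _ => ?_
    have h0 := pos_of_iid_pos hq.1 hω i
    have h1 := push_pos hq.1 (fun ω => (X ω, Y ω)) h0
    have h2 := push_pos hq.1 Y h0
    simp only [hg, neg_neg]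
    rw [Real.rpow_logb (by norm_num) (by norm_num) (by positivity), div_mul_cancel₀ _ h2.ne']
  refine ⟨N, fun n hn => ⟨?_, ?_⟩⟩
  · refine (prob_mono (iid_nonneg hq.1) fun ω hω h => ?_).trans (hN n hn)
    by_contra hc
    push Not at hc
    refine h ?_
    rw [key n ω hω]
    have h2 := push_pos (iid_nonneg hq.1) (fun (ω : Fin n → Ω) i => Y (ω i)) hω
    refine mul_le_mul_of_nonneg_right (Real.rpow_le_rpow_of_exponent_le (by norm_num) ?_) h2.le
    nlinarith [(abs_lt.1 hc).1]
  · refine (prob_mono (iid_nonneg hq.1) fun ω hω h => ?_).trans (hN n hn)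
    by_contra hc
    push Not at hc
    refine h ?_
    rw [key n ω hω]
    have h2 := push_pos (iid_nonneg hq.1) (fun (ω : Fin n → Ω) i => Y (ω i)) hω
    refine mul_le_mul_of_nonneg_right (Real.rpow_le_rpow_of_exponent_le (by norm_num) ?_) h2.le
    nlinarith [(abs_lt.1 hc).2]

/-- The uniform pmf. -/
noncomputable def unif (κ : Type*) [Fintype κ] (_ : κ) : ℝ := (Fintype.card κ : ℝ)⁻¹

lemma isPMF_unif (κ : Type*) [Fintype κ] [Nonempty κ] : IsPMF (unif κ) := by
  refine ⟨fun _ => by unfold unif; positivity, ?_⟩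
  have : (Fintype.card κ : ℝ) ≠ 0 := by exact_mod_cast Fintype.card_ne_zero
  simp [unif, this]

/-- The `L¹` distance between the law of `(Z, Y)` and the law of `Y` times the uniform law. -/
noncomputable def disc {ζ : Type*} [Fintype Ω] [Fintype ζ] [Fintype β] (P : Ω → ℝ)
    (Z : Ω → ζ) (Y : Ω → β) : ℝ :=
  ∑ z, ∑ y, |push P (fun ω => (Z ω, Y ω)) (z, y) - push P Y y / Fintype.card ζ|

section Discrepancy

variable {ζ ξ : Type*} [Fintype Ω] [Fintype ζ] [Fintype ξ] [Fintype β] [Fintype γ] {P : Ω → ℝ}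

lemma disc_comp_le (P : Ω → ℝ) (Z : Ω → ζ) (Y : Ω → β) (g : β → γ) :
    disc P Z (fun ω => g (Y ω)) ≤ disc P Z Y := by
  refine Finset.sum_le_sum fun z _ => ?_
  have h1 : ∀ c, |push P (fun ω => (Z ω, g (Y ω))) (z, c) -
      push P (fun ω => g (Y ω)) c / Fintype.card ζ| ≤
      ∑ y, (if g y = c then 1 else 0) *
        |push P (fun ω => (Z ω, Y ω)) (z, y) - push P Y y / Fintype.card ζ| := by
    intro c
    have e1 : push P (fun ω => (Z ω, g (Y ω))) (z, c) =
        ∑ y, push P (fun ω => (Z ω, Y ω)) (z, y) * (if g y = c then 1 else 0) := by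
      rw [← push_injective_comp (fun ω => (Z ω, g (Y ω))) Prod.swap_injective (z, c)]
      refine (push_pair_apply Y Z g c z).trans (Finset.sum_congr rfl fun y _ => ?_)
      rw [← push_injective_comp (fun ω => (Z ω, Y ω)) Prod.swap_injective (z, y)]
      rfl
    have e2 : push P (fun ω => g (Y ω)) c = ∑ y, push P Y y * (if g y = c then 1 else 0) := by
      rw [← push_comp Y g]
      simp [push]
    rw [e1, e2, Finset.sum_div, ← Finset.sum_sub_distrib]
    refine (Finset.abs_sum_le_sum_abs _ _).trans (Finset.sum_le_sum fun y _ => ?_)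
    split_ifs <;> simp
  refine (Finset.sum_le_sum fun c _ => h1 c).trans ?_
  rw [Finset.sum_comm]
  refine Finset.sum_le_sum fun y _ => ?_
  rw [← Finset.sum_mul]
  simp

lemma disc_prod_le (P : Ω → ℝ) (Z : Ω → ζ) (W : Ω → ξ) (Y : Ω → β) [Nonempty ζ] [Nonempty ξ] :
    disc P (fun ω => (Z ω, W ω)) Y ≤ disc P W (fun ω => (Z ω, Y ω)) + disc P Z Y := by
  have hξ : (Fintype.card ξ : ℝ) ≠ 0 := by exact_mod_cast Fintype.card_ne_zero
  have e : disc P Z Y = ∑ z, ∑ w : ξ, ∑ y,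
      |push P (fun ω => (Z ω, Y ω)) (z, y) / Fintype.card ξ -
        push P Y y / Fintype.card (ζ × ξ)| := by
    refine Finset.sum_congr rfl fun z _ => ?_
    rw [Finset.sum_const, Finset.card_univ, nsmul_eq_mul, Finset.mul_sum]
    refine Finset.sum_congr rfl fun y _ => ?_
    rw [Fintype.card_prod, Nat.cast_mul, ← div_div, ← sub_div, abs_div, Nat.abs_cast,
      mul_div_cancel₀ _ hξ]
  have e2 : disc P W (fun ω => (Z ω, Y ω)) = ∑ z, ∑ w : ξ, ∑ y,
      |push P (fun ω => ((Z ω, W ω), Y ω)) ((z, w), y) -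
        push P (fun ω => (Z ω, Y ω)) (z, y) / Fintype.card ξ| := by
    unfold disc
    simp_rw [Fintype.sum_prod_type]
    rw [Finset.sum_comm]
    refine Finset.sum_congr rfl fun z _ => Finset.sum_congr rfl fun w _ =>
      Finset.sum_congr rfl fun y _ => ?_
    rw [← push_injective_comp (fun ω => ((Z ω, W ω), Y ω))
      (e := fun t => (t.1.2, t.1.1, t.2)) (fun a b hab => by grind) ((z, w), y)]
  rw [e, e2, disc, Fintype.sum_prod_type, ← Finset.sum_add_distrib]
  refine Finset.sum_le_sum fun z _ => ?_
  rw [← Finset.sum_add_distrib]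
  refine Finset.sum_le_sum fun w _ => ?_
  rw [← Finset.sum_add_distrib]
  exact Finset.sum_le_sum fun y _ => abs_sub_le _ _ _

end Discrepancy

section RandomBinning

variable {κ ζ : Type*} [Fintype Ω] [Fintype α] [DecidableEq α] [Fintype β] [Fintype κ] [Nonempty κ] [Fintype ζ]
  [Nonempty ζ] {P : Ω → ℝ}

/-- The average discrepancy of a random binning extracting uniform randomness. -/
lemma sum_iid_unif_mul_disc_le (hP : IsPMF P) (X : Ω → α) (Y : Ω → β) (π : κ → ζ)
    (hπ : ∀ z, push (unif κ) π z = (Fintype.card ζ : ℝ)⁻¹) {τ : ℝ} (hτ : 0 ≤ τ) :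
    ∑ φ : α → κ, iid (unif κ) φ * disc P (fun ω => π (φ (X ω))) Y ≤
      2 * prob P (fun ω => ¬ (push P (fun ω => (X ω, Y ω)) (X ω, Y ω) ≤ τ * push P Y (Y ω)))
        + √(τ * (Fintype.card ζ - 1)) := by
  have hunif := isPMF_unif κ
  have hiid : IsPMF (iid (unif κ) : (α → κ) → ℝ) := isPMF_iid hunif
  set N : ℝ := (Fintype.card ζ : ℝ) with hN
  have hN1 : 1 ≤ N := by
    rw [hN]; exact_mod_cast Fintype.card_pos (α := ζ)
  set r : α × β → ℝ := push P (fun ω => (X ω, Y ω)) with hr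
  have hr0 : ∀ t, 0 ≤ r t := push_nonneg hP.1 _
  have hry0 : ∀ y, 0 ≤ push P Y y := push_nonneg hP.1 _
  set c : β → α → ℝ := fun y x => if r (x, y) ≤ τ * push P Y y then r (x, y) else 0 with hc
  set b : β → α → ℝ := fun y x => if r (x, y) ≤ τ * push P Y y then 0 else r (x, y) with hb
  have hb0 : ∀ y x, 0 ≤ b y x := fun y x => by simp only [hb]; split_ifs <;> simp [hr0]
  have hc0 : ∀ y x, 0 ≤ c y x := fun y x => by simp only [hc]; split_ifs <;> simp [hr0]
  set u : ζ → κ → ℝ := fun z k => (if π k = z then 1 else 0) - N⁻¹ with hu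
  have hu0 : ∀ z, ∑ k, unif κ k * u z k = 0 := by
    intro z
    have := hπ z
    simp only [push] at this
    simp only [hu, mul_sub, mul_ite, mul_one, mul_zero, Finset.sum_sub_distrib, this,
      ← Finset.sum_mul, hunif.2]
    simp
  have hu2 : ∀ z, ∑ k, unif κ k * u z k ^ 2 = N⁻¹ * (1 - N⁻¹) := by
    intro z
    have h1 : ∀ k, unif κ k * u z k ^ 2 = (if π k = z then unif κ k else 0) * (1 - N⁻¹)
        - N⁻¹ * (unif κ k * u z k) := by
      intro k
      simp only [hu]
      split_ifs <;> ring
    simp_rw [h1, Finset.sum_sub_distrib, ← Finset.sum_mul, ← Finset.mul_sum, hu0]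
    have := hπ z
    simp only [push] at this
    rw [this]; ring
  -- split into the regular and the exceptional part
  have hsplit : ∀ φ : α → κ, disc P (fun ω => π (φ (X ω))) Y ≤
      ∑ z, ∑ y, |∑ x, c y x * u z (φ x)| + 2 * ∑ y, ∑ x, b y x := by
    intro φ
    have h1 : ∀ z y, push P (fun ω => (π (φ (X ω)), Y ω)) (z, y) - push P Y y / N =
        ∑ x, c y x * u z (φ x) + ∑ x, b y x * u z (φ x) := by
      intro z y
      rw [push_pair_apply X Y (fun x => π (φ x)), ← sum_push_pair X Y y, Finset.sum_div,
        ← Finset.sum_sub_distrib, ← Finset.sum_add_distrib]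
      refine Finset.sum_congr rfl fun x _ => ?_
      rw [← add_mul]
      have : c y x + b y x = r (x, y) := by simp only [hc, hb]; split_ifs <;> simp
      rw [this]
      simp only [hu, ← hr]
      ring
    have h2 : ∀ k, ∑ z, |u z k| ≤ 2 := by
      intro k
      have : ∀ z, |u z k| ≤ (if π k = z then 1 else 0) + N⁻¹ := by
        intro z
        refine (abs_sub _ _).trans ?_
        rw [abs_of_nonneg (inv_nonneg.2 (by linarith : 0 ≤ N))]
        split_ifs <;> simp
      refine (Finset.sum_le_sum fun z _ => this z).trans ?_
      rw [Finset.sum_add_distrib, Finset.sum_const, Finset.card_univ, nsmul_eq_mul, ← hN,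
        mul_inv_cancel₀ (by linarith)]
      simp; norm_num
    unfold disc
    simp_rw [← hN, h1]
    have h3 : ∑ z, ∑ y, |∑ x, b y x * u z (φ x)| ≤ 2 * ∑ y, ∑ x, b y x := by
      rw [Finset.sum_comm, Finset.mul_sum]
      refine Finset.sum_le_sum fun y _ => ?_
      calc ∑ z, |∑ x, b y x * u z (φ x)| ≤ ∑ z, ∑ x, b y x * |u z (φ x)| := by
            refine Finset.sum_le_sum fun z _ => (Finset.abs_sum_le_sum_abs _ _).trans_eq ?_
            exact Finset.sum_congr rfl fun x _ => by rw [abs_mul, abs_of_nonneg (hb0 y x)]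
        _ = ∑ x, b y x * ∑ z, |u z (φ x)| := by
            rw [Finset.sum_comm]
            exact Finset.sum_congr rfl fun x _ => by rw [Finset.mul_sum]
        _ ≤ ∑ x, b y x * 2 :=
            Finset.sum_le_sum fun x _ => mul_le_mul_of_nonneg_left (h2 _) (hb0 y x)
        _ = 2 * ∑ x, b y x := by rw [← Finset.sum_mul, mul_comm]
    refine le_trans ?_ (add_le_add_right h3 _)
    rw [← Finset.sum_add_distrib]
    refine Finset.sum_le_sum fun z _ => ?_
    rw [← Finset.sum_add_distrib]
    exact Finset.sum_le_sum fun y _ => abs_add_le _ _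
  have hbad : ∑ y, ∑ x, b y x = prob P (fun ω => ¬ (r (X ω, Y ω) ≤ τ * push P Y (Y ω))) := by
    rw [Finset.sum_comm, ← Fintype.sum_prod_type (f := fun t : α × β => b t.2 t.1)]
    have := sum_push_mul (P := P) (fun ω => (X ω, Y ω))
      (fun t => if r t ≤ τ * push P Y t.2 then 0 else 1)
    simp only [mul_ite, mul_zero, mul_one] at this
    exact this.trans (Finset.sum_congr rfl fun ω _ => by
      beta_reduce; split_ifs <;> rfl)
  have hgood : ∀ z y, ∑ φ : α → κ, iid (unif κ) φ * |∑ x, c y x * u z (φ x)| ≤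
      push P Y y * (√(τ * (N - 1)) * N⁻¹) := by
    intro z y
    have hsq : (∑ φ : α → κ, iid (unif κ) φ * |∑ x, c y x * u z (φ x)|) ^ 2 ≤
        ∑ φ : α → κ, iid (unif κ) φ * (∑ x, c y x * u z (φ x)) ^ 2 := by
      have h := Finset.sum_sq_le_sum_mul_sum_of_sq_le_mul (Finset.univ : Finset (α → κ))
        (r := fun φ => iid (unif κ) φ * |∑ x, c y x * u z (φ x)|)
        (f := fun φ => iid (unif κ) φ)
        (g := fun φ => iid (unif κ) φ * (∑ x, c y x * u z (φ x)) ^ 2)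
        (fun φ _ => hiid.1 φ) (fun φ _ => mul_nonneg (hiid.1 φ) (sq_nonneg _))
        (fun φ _ => by rw [mul_pow, sq_abs]; exact le_of_eq (by ring))
      rwa [hiid.2, one_mul] at h
    rw [sum_iid_mul_sq hunif (c y) (u z) (hu0 z), hu2] at hsq
    have hcs : ∑ x, c y x ^ 2 ≤ τ * push P Y y ^ 2 := by
      have : ∀ x, c y x ^ 2 ≤ τ * push P Y y * r (x, y) := by
        intro x
        simp only [hc]
        split_ifs with h
        · rw [sq]; exact mul_le_mul_of_nonneg_right h (hr0 _)
        · have := mul_nonneg (mul_nonneg hτ (hry0 y)) (hr0 (x, y))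
          simpa using this
      refine (Finset.sum_le_sum fun x _ => this x).trans_eq ?_
      rw [← Finset.mul_sum, hr, sum_push_pair]; ring
    have hN2 : 0 ≤ N⁻¹ * (1 - N⁻¹) :=
      mul_nonneg (by positivity) (sub_nonneg.2 (inv_le_one_of_one_le₀ hN1))
    have hN0 : N ≠ 0 := by linarith
    refine abs_le_of_sq_le_sq' (a := ∑ φ : α → κ, iid (unif κ) φ * |∑ x, c y x * u z (φ x)|)
      ?_ (by have := hry0 y; positivity) |>.2
    refine hsq.trans ((mul_le_mul_of_nonneg_right hcs hN2).trans_eq ?_)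
    rw [mul_pow, mul_pow, Real.sq_sqrt (mul_nonneg hτ (by linarith))]
    field_simp
  calc ∑ φ : α → κ, iid (unif κ) φ * disc P (fun ω => π (φ (X ω))) Y
      ≤ ∑ φ : α → κ, iid (unif κ) φ *
          (∑ z, ∑ y, |∑ x, c y x * u z (φ x)| + 2 * ∑ y, ∑ x, b y x) :=
        Finset.sum_le_sum fun φ _ => mul_le_mul_of_nonneg_left (hsplit φ) (hiid.1 φ)
    _ = 2 * (∑ y, ∑ x, b y x) +
          ∑ z, ∑ y, ∑ φ : α → κ, iid (unif κ) φ * |∑ x, c y x * u z (φ x)| := by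
        simp_rw [mul_add, Finset.sum_add_distrib, ← Finset.sum_mul, hiid.2, one_mul, add_comm,
          Finset.mul_sum]
        congr 1
        rw [Finset.sum_comm]
        exact Finset.sum_congr rfl fun z _ => Finset.sum_comm
    _ ≤ 2 * (∑ y, ∑ x, b y x) + ∑ z : ζ, ∑ y, push P Y y * (√(τ * (N - 1)) * N⁻¹) :=
        add_le_add_right (Finset.sum_le_sum fun z _ => Finset.sum_le_sum fun y _ => hgood z y) _
    _ = _ := by
        rw [hbad]
        simp_rw [← Finset.sum_mul, (isPMF_push hP Y).2]
        rw [Finset.sum_const, Finset.card_univ, nsmul_eq_mul, ← hN]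
        have hN0 : N ≠ 0 := by linarith
        field_simp

/-- The threshold decoder for Slepian–Wolf binning fails. -/
def BinningFailure (P : Ω → ℝ) (X : Ω → α) (Y : Ω → β) (τ : ℝ) (ψ : α → ζ) (ω : Ω) : Prop :=
  ¬ (τ * push P Y (Y ω) ≤ push P (fun ω => (X ω, Y ω)) (X ω, Y ω)) ∨
    ∃ x, x ≠ X ω ∧ τ * push P Y (Y ω) ≤ push P (fun ω => (X ω, Y ω)) (x, Y ω) ∧
      ψ x = ψ (X ω)

lemma exists_decoder [Nonempty α] (hP : ∀ ω, 0 ≤ P ω) (X : Ω → α) (Y : Ω → β) (τ : ℝ)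
    (ψ : α → ζ) : ∃ dec : ζ → β → α,
      prob P (fun ω => dec (ψ (X ω)) (Y ω) ≠ X ω) ≤ prob P (BinningFailure P X Y τ ψ) := by
  let good : ζ → β → α → Prop := fun z y x =>
    τ * push P Y y ≤ push P (fun ω => (X ω, Y ω)) (x, y) ∧ ψ x = z
  refine ⟨fun z y => if h : ∃ x, good z y x then h.choose else Classical.arbitrary α, ?_⟩
  refine prob_mono hP fun ω _ hne => ?_
  by_contra hc
  simp only [BinningFailure, not_or, not_not, not_exists, not_and] at hc
  have hex : ∃ x, good (ψ (X ω)) (Y ω) x := ⟨X ω, hc.1, rfl⟩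
  simp only [dif_pos hex] at hne
  exact hc.2 _ hne hex.choose_spec.1 hex.choose_spec.2

/-- The average failure probability of the threshold decoder for a random binning. -/
lemma sum_iid_unif_mul_prob_failure_le (hP : IsPMF P) (X : Ω → α) (Y : Ω → β) (π : κ → ζ)
    (hπ : ∀ z, push (unif κ) π z = (Fintype.card ζ : ℝ)⁻¹) {τ : ℝ} (hτ : 0 < τ) :
    ∑ φ : α → κ, iid (unif κ) φ * prob P (BinningFailure P X Y τ (fun x => π (φ x))) ≤
      prob P (fun ω => ¬ (τ * push P Y (Y ω) ≤ push P (fun ω => (X ω, Y ω)) (X ω, Y ω)))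
        + (τ * Fintype.card ζ)⁻¹ := by
  have hunif := isPMF_unif κ
  have hiid : IsPMF (iid (unif κ) : (α → κ) → ℝ) := isPMF_iid hunif
  set N : ℝ := (Fintype.card ζ : ℝ) with hN
  have hN1 : 1 ≤ N := by
    rw [hN]; exact_mod_cast Fintype.card_pos (α := ζ)
  set r : α × β → ℝ := push P (fun ω => (X ω, Y ω)) with hr
  have hr0 : ∀ t, 0 ≤ r t := push_nonneg hP.1 _
  have hcoll : ∀ x x' : α, x ≠ x' →
      ∑ φ : α → κ, iid (unif κ) φ * (if π (φ x) = π (φ x') then 1 else 0) = N⁻¹ := by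
    intro x x' hx
    have h1 : ∀ φ : α → κ, (if π (φ x) = π (φ x') then (1 : ℝ) else 0) =
        ∑ z, (if π (φ x) = z then 1 else 0) * (if π (φ x') = z then 1 else 0) := by
      intro φ
      rw [Finset.sum_eq_single (π (φ x))]
      · simp [eq_comm]
      · intro z _ hz; simp [hz.symm]
      · simp
    simp_rw [h1, Finset.mul_sum]
    rw [Finset.sum_comm]
    have h2 : ∀ z, ∑ φ : α → κ, iid (unif κ) φ *
        ((if π (φ x) = z then 1 else 0) * (if π (φ x') = z then 1 else 0)) = N⁻¹ * N⁻¹ := by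
      intro z
      rw [sum_iid_mul_apply_mul_apply hunif hx (fun k => if π k = z then 1 else 0)
        (fun k => if π k = z then 1 else 0)]
      have := hπ z
      simp only [push] at this
      simp only [mul_ite, mul_one, mul_zero, this]
    simp_rw [h2]
    rw [Finset.sum_const, Finset.card_univ, nsmul_eq_mul, ← hN, ← mul_assoc,
      mul_inv_cancel₀ (by linarith), one_mul]
  have hcount : ∀ y, 0 < push P Y y →
      ∑ x, (if τ * push P Y y ≤ r (x, y) then 1 else 0) ≤ τ⁻¹ := by
    intro y hy
    have h1 : (∑ x, (if τ * push P Y y ≤ r (x, y) then 1 else 0)) * (τ * push P Y y) ≤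
        push P Y y := by
      rw [Finset.sum_mul]
      conv_rhs => rw [← sum_push_pair X Y y]
      refine Finset.sum_le_sum fun x _ => ?_
      split_ifs with h
      · simpa using h
      · simpa using hr0 (x, y)
    rw [← mul_assoc] at h1
    rw [← one_div, le_div_iff₀ hτ]
    exact le_of_mul_le_mul_right (by rwa [one_mul]) hy
  set v : Ω → α → ℝ := fun ω x =>
    if x ≠ X ω ∧ τ * push P Y (Y ω) ≤ r (x, Y ω) then 1 else 0 with hv
  have hv0 : ∀ ω x, 0 ≤ v ω x := fun ω x => by simp only [hv]; split_ifs <;> simp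
  have hfail : ∀ φ : α → κ, prob P (BinningFailure P X Y τ (fun x => π (φ x))) ≤
      prob P (fun ω => ¬ (τ * push P Y (Y ω) ≤ r (X ω, Y ω))) +
        ∑ ω, P ω * ∑ x, v ω x * (if π (φ x) = π (φ (X ω)) then 1 else 0) := by
    intro φ
    refine (prob_or_le hP.1 _ _).trans (add_le_add_right ?_ _)
    refine Finset.sum_le_sum fun ω _ => ?_
    have hnn : ∀ x ∈ Finset.univ,
        0 ≤ v ω x * (if π (φ x) = π (φ (X ω)) then (1 : ℝ) else 0) := fun x _ =>
      mul_nonneg (hv0 ω x) (by split_ifs <;> simp)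
    split_ifs with h
    · obtain ⟨x, hx, hgood, heq⟩ := h
      have h1 : (1 : ℝ) ≤ ∑ x, v ω x * (if π (φ x) = π (φ (X ω)) then 1 else 0) := by
        refine le_trans ?_ (Finset.single_le_sum hnn (Finset.mem_univ x))
        simp only [hv]
        rw [if_pos ⟨hx, hgood⟩, if_pos heq, one_mul]
      exact le_mul_of_one_le_right (hP.1 ω) h1
    · exact mul_nonneg (hP.1 ω) (Finset.sum_nonneg hnn)
  have havg : ∀ ω, P ω * ∑ x, v ω x * (∑ φ : α → κ, iid (unif κ) φ *
      (if π (φ x) = π (φ (X ω)) then 1 else 0)) ≤ P ω * (τ * N)⁻¹ := by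
    intro ω
    rcases (hP.1 ω).eq_or_lt with h0 | h0
    · simp [← h0]
    refine mul_le_mul_of_nonneg_left ?_ h0.le
    have hN0 : 0 ≤ N⁻¹ := inv_nonneg.2 (by linarith)
    calc _ ≤ ∑ x, (if τ * push P Y (Y ω) ≤ r (x, Y ω) then 1 else 0) * N⁻¹ := by
          refine Finset.sum_le_sum fun x _ => ?_
          by_cases hx : x = X ω
          · simp only [hv, hx, ne_eq, not_true_eq_false, false_and, if_false, zero_mul]
            split_ifs <;> simp [hN0]
          · rw [hcoll x _ hx]
            simp [hv, hx]
      _ ≤ τ⁻¹ * N⁻¹ := by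
          rw [← Finset.sum_mul]
          exact mul_le_mul_of_nonneg_right (hcount _ (push_pos hP.1 Y h0)) hN0
      _ = (τ * N)⁻¹ := by rw [mul_inv]
  calc _ ≤ ∑ φ : α → κ, iid (unif κ) φ *
        (prob P (fun ω => ¬ (τ * push P Y (Y ω) ≤ r (X ω, Y ω))) +
        ∑ ω, P ω * ∑ x, v ω x * (if π (φ x) = π (φ (X ω)) then 1 else 0)) :=
        Finset.sum_le_sum fun φ _ => mul_le_mul_of_nonneg_left (hfail φ) (hiid.1 φ)
    _ = prob P (fun ω => ¬ (τ * push P Y (Y ω) ≤ r (X ω, Y ω))) +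
        ∑ ω, P ω * ∑ x, v ω x * (∑ φ : α → κ, iid (unif κ) φ *
          (if π (φ x) = π (φ (X ω)) then 1 else 0)) := by
        simp_rw [mul_add, Finset.sum_add_distrib, ← Finset.sum_mul, hiid.2, one_mul]
        congr 1
        simp_rw [Finset.mul_sum]
        rw [Finset.sum_comm]
        refine Finset.sum_congr rfl fun ω _ => ?_
        rw [Finset.sum_comm]
        exact Finset.sum_congr rfl fun x _ => Finset.sum_congr rfl fun φ _ => by ring
    _ ≤ _ := by
        refine add_le_add_right ((Finset.sum_le_sum fun ω _ => havg ω).trans_eq ?_) _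
        rw [← Finset.sum_mul, hP.2, one_mul]

end RandomBinning

lemma IsPMF.exists_pos [Fintype Ω] {P : Ω → ℝ} (hP : IsPMF P) : ∃ ω, 0 < P ω := by
  by_contra! h0
  have : ∑ ω, P ω ≤ 0 := Finset.sum_nonpos fun ω _ => h0 ω
  linarith [hP.2]

lemma exists_add_add_le_of_expVal_le [Fintype Ω] {P : Ω → ℝ} (hP : IsPMF P) {f g h : Ω → ℝ}
    {a b c : ℝ} (hf : ∑ ω, P ω * f ω ≤ a) (hg : ∑ ω, P ω * g ω ≤ b) (hh : ∑ ω, P ω * h ω ≤ c) :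
    ∃ ω, f ω + g ω + h ω ≤ a + b + c := by
  refine exists_le_of_expVal_le hP ?_
  simp_rw [mul_add, Finset.sum_add_distrib]
  linarith

lemma exists_rpow_neg_mul_le {δ η : ℝ} (hδ : 0 < δ) (hη : 0 < η) :
    ∃ N : ℕ, ∀ n ≥ N, (2 : ℝ) ^ (-(n * δ)) ≤ η := by
  have h1 : (2 : ℝ) ^ (-δ) < 1 := Real.rpow_lt_one_of_one_lt_of_neg one_lt_two (by linarith)
  have h2 := tendsto_pow_atTop_nhds_zero_of_lt_one (Real.rpow_nonneg zero_le_two (-δ)) h1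
  obtain ⟨N, hN⟩ := Filter.eventually_atTop.1 (h2.eventually (ge_mem_nhds hη))
  refine ⟨N, fun n hn => ?_⟩
  have := hN n hn
  rwa [← Real.rpow_natCast, ← Real.rpow_mul zero_le_two, neg_mul, mul_comm] at this

lemma push_unif_id (κ : Type*) [Fintype κ] (z : κ) :
    push (unif κ) (fun k => k) z = (Fintype.card κ : ℝ)⁻¹ := by
  simp [push, unif]

lemma push_unif_fst {κ ξ : Type*} [Fintype κ] [Fintype ξ] [Nonempty ξ] (z : κ) :
    push (unif (κ × ξ)) (fun k => k.1) z = (Fintype.card κ : ℝ)⁻¹ := by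
  have : (Fintype.card ξ : ℝ) ≠ 0 := by exact_mod_cast Fintype.card_ne_zero
  unfold push unif
  rw [Fintype.sum_prod_type, Finset.sum_eq_single z]
  · simp only [if_true, Finset.sum_const, Finset.card_univ, nsmul_eq_mul, Fintype.card_prod,
      Nat.cast_mul, mul_inv]
    field_simp
  · intro b _ hb
    simp [hb]
  · simp

lemma push_unif_fst_fst {κ ξ υ : Type*} [Fintype κ] [Fintype ξ] [Fintype υ] [Nonempty υ]
    (z : κ × ξ) :
    push (unif (κ × ξ × υ)) (fun k => (k.1, k.2.1)) z = (Fintype.card (κ × ξ) : ℝ)⁻¹ := by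
  rw [← push_unif_fst (ξ := υ) z]
  unfold push unif
  refine Fintype.sum_equiv (Equiv.prodAssoc κ ξ υ).symm _ _ fun k => ?_
  simp [mul_assoc]

/-- Simultaneous random binning: the first index is almost uniform and independent of `Y₁ⁿ`,
the first two indices determine `Xⁿ` from `Y₂ⁿ`, and all of them determine it from `Y₃ⁿ`. -/
lemma exists_binning {β₁ β₂ β₃ : Type*} [Fintype Ω] [Fintype α] [Fintype β₁] [Fintype β₂]
    [Fintype β₃] {q : Ω → ℝ} (hq : IsPMF q) (X : Ω → α) (Y₁ : Ω → β₁) (Y₂ : Ω → β₂)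
    (Y₃ : Ω → β₃) {δ η : ℝ} (hδ : 0 < δ) (hη : 0 < η) :
    ∃ N : ℕ, ∀ n ≥ N, ∀ F M L : ℕ, 0 < F → 0 < M → 0 < L →
      (F : ℝ) - 1 ≤ 2 ^ (n * (condEntRV q X Y₁ - δ)) →
      2 ^ (n * (condEntRV q X Y₂ + δ)) ≤ (F * M : ℝ) →
      2 ^ (n * (condEntRV q X Y₃ + δ)) ≤ (F * M * L : ℝ) →
      ∃ (φ : (Fin n → α) → Fin F × Fin M × Fin L)
        (dec₂ : Fin F × Fin M → (Fin n → β₂) → Fin n → α)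
        (dec₃ : Fin F × Fin M × Fin L → (Fin n → β₃) → Fin n → α),
        disc (iid q) (fun ω : Fin n → Ω => (φ fun i => X (ω i)).1) (fun ω i => Y₁ (ω i)) ≤ η ∧
        prob (iid q) (fun ω : Fin n → Ω =>
          dec₂ ((φ fun i => X (ω i)).1, (φ fun i => X (ω i)).2.1) (fun i => Y₂ (ω i))
            ≠ fun i => X (ω i)) ≤ η ∧
        prob (iid q) (fun ω : Fin n → Ω =>
          dec₃ (φ fun i => X (ω i)) (fun i => Y₃ (ω i)) ≠ fun i => X (ω i)) ≤ η := by
  obtain ⟨N₁, hN₁⟩ := exists_conditional_aep hq X Y₁ (half_pos hδ) (show 0 < η / 8 by linarith)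
  obtain ⟨N₂, hN₂⟩ := exists_conditional_aep hq X Y₂ (half_pos hδ) (show 0 < η / 8 by linarith)
  obtain ⟨N₃, hN₃⟩ := exists_conditional_aep hq X Y₃ (half_pos hδ) (show 0 < η / 8 by linarith)
  obtain ⟨N₄, hN₄⟩ := exists_rpow_neg_mul_le (show 0 < δ / 4 by linarith)
    (show 0 < η / 8 by linarith)
  refine ⟨max (max N₁ N₂) (max N₃ N₄), fun n hn F M L hF hM hL hc₁ hc₂ hc₃ => ?_⟩
  simp only [ge_iff_le, max_le_iff] at hn
  have : Nonempty (Fin F) := ⟨⟨0, hF⟩⟩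
  have : Nonempty (Fin M) := ⟨⟨0, hM⟩⟩
  have : Nonempty (Fin L) := ⟨⟨0, hL⟩⟩
  obtain ⟨ω₀, -⟩ := hq.exists_pos
  have : Nonempty α := ⟨X ω₀⟩
  have hP : IsPMF (iid q : (Fin n → Ω) → ℝ) := isPMF_iid hq
  have hiid : IsPMF (iid (unif (Fin F × Fin M × Fin L)) :
    ((Fin n → α) → Fin F × Fin M × Fin L) → ℝ) := isPMF_iid (isPMF_unif _)
  set P : (Fin n → Ω) → ℝ := iid q with hPdef
  have hsmall : (2 : ℝ) ^ (-(n * (δ / 4))) ≤ η / 8 := hN₄ n hn.2.2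
  have hsmall2 : (2 : ℝ) ^ (-(n * (δ / 2))) ≤ η / 8 := by
    refine le_trans (Real.rpow_le_rpow_of_exponent_le one_le_two ?_) hsmall
    have : 0 ≤ n * δ := by positivity
    linarith
  have b₁ := sum_iid_unif_mul_disc_le hP (fun ω i => X (ω i)) (fun ω i => Y₁ (ω i))
    (fun k : Fin F × Fin M × Fin L => k.1) push_unif_fst
    (τ := 2 ^ (-(n * (condEntRV q X Y₁ - δ / 2)))) (by positivity)
  have b₂ := sum_iid_unif_mul_prob_failure_le hP (fun ω i => X (ω i)) (fun ω i => Y₂ (ω i))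
    (fun k : Fin F × Fin M × Fin L => (k.1, k.2.1)) push_unif_fst_fst
    (τ := 2 ^ (-(n * (condEntRV q X Y₂ + δ / 2)))) (by positivity)
  have b₃ := sum_iid_unif_mul_prob_failure_le hP (fun ω i => X (ω i)) (fun ω i => Y₃ (ω i))
    (fun k : Fin F × Fin M × Fin L => k) (push_unif_id _)
    (τ := 2 ^ (-(n * (condEntRV q X Y₃ + δ / 2)))) (by positivity)
  have e₁ : √((2 : ℝ) ^ (-(n * (condEntRV q X Y₁ - δ / 2))) *
      ((Fintype.card (Fin F) : ℝ) - 1)) ≤ η / 8 := by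
    refine le_trans (Real.sqrt_le_sqrt (y := ((2 : ℝ) ^ (-(n * (δ / 4)))) ^ 2) ?_)
      ((Real.sqrt_sq (by positivity)).trans_le hsmall)
    rw [Fintype.card_fin]
    refine (mul_le_mul_of_nonneg_left hc₁ (by positivity)).trans_eq ?_
    rw [← Real.rpow_add two_pos, ← Real.rpow_natCast, ← Real.rpow_mul zero_le_two]
    congr 1
    push_cast
    ring
  have e : ∀ H C : ℝ, 2 ^ (n * (H + δ)) ≤ C →
      ((2 : ℝ) ^ (-(n * (H + δ / 2))) * C)⁻¹ ≤ η / 8 := by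
    intro H C hC
    refine le_trans ?_ hsmall2
    rw [Real.rpow_neg zero_le_two (n * (δ / 2))]
    refine inv_anti₀ (by positivity) ?_
    refine le_trans (le_of_eq ?_) (mul_le_mul_of_nonneg_left hC (by positivity))
    rw [← Real.rpow_add two_pos]
    congr 1
    ring
  have e₂ := e _ _ hc₂
  have e₃ := e _ _ hc₃
  simp only [Fintype.card_prod, Fintype.card_fin, Nat.cast_mul] at b₁ b₂ b₃ e₁
  rw [← mul_assoc (F : ℝ)] at b₃
  have a₁ := (hN₁ n hn.1.1).1
  have a₂ := (hN₂ n hn.1.2).2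
  have a₃ := (hN₃ n hn.2.1).2
  obtain ⟨φ, hφ⟩ := exists_add_add_le_of_expVal_le hiid (h := fun φ => _) b₁ b₂ b₃
  obtain ⟨dec₂, hd₂⟩ := exists_decoder hP.1 (fun ω i => X (ω i)) (fun ω i => Y₂ (ω i))
    (2 ^ (-(n * (condEntRV q X Y₂ + δ / 2)))) (fun x => ((φ x).1, (φ x).2.1))
  obtain ⟨dec₃, hd₃⟩ := exists_decoder hP.1 (fun ω i => X (ω i)) (fun ω i => Y₃ (ω i))
    (2 ^ (-(n * (condEntRV q X Y₃ + δ / 2)))) φ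
  have n₁ : 0 ≤ disc P (fun ω : Fin n → Ω => (φ fun i => X (ω i)).1) (fun ω i => Y₁ (ω i)) :=
    Finset.sum_nonneg fun z _ => Finset.sum_nonneg fun y _ => abs_nonneg _
  have n₂ := prob_nonneg hP.1 (BinningFailure P (fun ω i => X (ω i)) (fun ω i => Y₂ (ω i))
        (2 ^ (-(n * (condEntRV q X Y₂ + δ / 2)))) (fun x => ((φ x).1, (φ x).2.1)))
  have n₃ := prob_nonneg hP.1 (BinningFailure P (fun ω i => X (ω i)) (fun ω i => Y₃ (ω i))
        (2 ^ (-(n * (condEntRV q X Y₃ + δ / 2)))) φ)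
  exact ⟨φ, dec₂, dec₃, by linarith, hd₂.trans (by linarith), hd₃.trans (by linarith)⟩

/-- Derandomization: if the bin index `φ(X)` is almost uniform and independent of `S = σ(T)`, then
some fixed bin index `f` and some deterministic selection of `X` as a function of `S` do almost as
well as the random source. -/
lemma exists_deterministic_encoder {ζ : Type*} [Fintype Ω] [Fintype α] [Nonempty α] [Fintype β]
    [Fintype γ] [Fintype ζ] [Nonempty ζ] {P : Ω → ℝ} (hP : IsPMF P) (X : Ω → α) (T : Ω → γ)
    (σ : γ → β) (hM : MarkovChain P X (fun ω => σ (T ω)) T) (φ : α → ζ)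
    (bad : ζ → α → γ → Prop) :
    ∃ (f : ζ) (e : β → α), prob (push P T) (fun t => bad f (e (σ t)) t) ≤
      prob P (fun ω => bad (φ (X ω)) (X ω) (T ω)) +
        disc P (fun ω => φ (X ω)) (fun ω => σ (T ω)) := by
  set p := push P T with hp
  set pS := push P (fun ω => σ (T ω)) with hpS
  set xs := push P (fun ω => (X ω, σ (T ω))) with hxs
  set N : ℝ := (Fintype.card ζ : ℝ) with hN
  have hp0 : ∀ t, 0 ≤ p t := push_nonneg hP.1 _
  have hpS0 : ∀ s, 0 ≤ pS s := push_nonneg hP.1 _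
  have hxs0 : ∀ t, 0 ≤ xs t := push_nonneg hP.1 _
  set w : ζ → β → α → ℝ := fun f s x =>
    ∑ t, if σ t = s then (if bad f x t then p t else 0) else 0 with hw
  have hw0 : ∀ f s x, 0 ≤ w f s x := fun f s x => Finset.sum_nonneg fun t _ => by
    split_ifs <;> simp [hp0]
  have hwle : ∀ f s x, w f s x ≤ pS s := by
    intro f s x
    have : pS s = ∑ t, if σ t = s then p t else 0 := by
      rw [hpS, ← push_comp T σ]; rfl
    rw [this]
    refine Finset.sum_le_sum fun t _ => ?_
    split_ifs <;> simp [hp0]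
  have hmin : ∀ f s, ∃ x, ∀ x', φ x' = f → w f s x ≤ w f s x' := by
    intro f s
    by_cases h : ∃ x, φ x = f
    · obtain ⟨x₀, h₀⟩ := h
      obtain ⟨x, -, hx⟩ := Finset.exists_min_image (Finset.univ.filter fun x => φ x = f) (w f s)
        ⟨x₀, by simp [h₀]⟩
      exact ⟨x, fun x' hx' => hx x' (by simp [hx'])⟩
    · push Not at h
      exact ⟨Classical.arbitrary α, fun x' hx' => absurd hx' (h x')⟩
  choose e he using hmin
  have hJ : ∀ f s, push P (fun ω => (φ (X ω), σ (T ω))) (f, s) =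
      ∑ x, xs (x, s) * (if φ x = f then 1 else 0) := fun f s => push_pair_apply X _ φ f s
  have hxt : ∀ x t, xs (x, σ t) * p t / pS (σ t) = push P (fun ω => (X ω, T ω)) (x, t) := by
    intro x t
    have h1 := hM x (σ t) t
    rw [push_injective_comp (fun ω => (X ω, T ω)) (e := fun u : α × γ => (u.1, σ u.2, u.2))
      (fun a b hab => by grind) (x, t), push_injective_comp T (e := fun t => (t, σ t))
      (fun a b hab => by grind) t] at h1
    rcases (hpS0 (σ t)).eq_or_lt with h0 | h0
    · rw [← h0, div_zero]
      refine le_antisymm (push_nonneg hP.1 _ _) ?_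
      rw [h0, hpS]
      exact push_le_push hP.1 _ _ _ _ fun ω hω => congrArg (fun u : α × γ => σ u.2) hω
    · rw [div_eq_iff h0.ne', ← h1]
  have hterm : ∀ f s, w f s (e f s) / N ≤
      |push P (fun ω => (φ (X ω), σ (T ω))) (f, s) - pS s / N| +
      ∑ x, xs (x, s) * (if φ x = f then 1 else 0) * w f s x / pS s := by
    intro f s
    have h1 : ∑ x, xs (x, s) * (if φ x = f then 1 else 0) * w f s (e f s) / pS s ≤
        ∑ x, xs (x, s) * (if φ x = f then 1 else 0) * w f s x / pS s := by
      refine Finset.sum_le_sum fun x _ => div_le_div_of_nonneg_right ?_ (hpS0 s)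
      by_cases hx : φ x = f
      · simpa [hx] using mul_le_mul_of_nonneg_left (he f s x hx) (hxs0 (x, s))
      · simp [hx]
    refine le_trans ?_ (add_le_add_right h1 _)
    rw [← Finset.sum_div, ← Finset.sum_mul, ← hJ]
    set J := push P (fun ω => (φ (X ω), σ (T ω))) (f, s)
    rcases (hpS0 s).eq_or_lt with h0 | h0
    · have : w f s (e f s) = 0 := le_antisymm (h0 ▸ hwle f s _) (hw0 _ _ _)
      rw [this, zero_div, mul_zero, zero_div, add_zero]
      exact abs_nonneg _
    · have h2 : w f s (e f s) / N = (w f s (e f s) / pS s) * (pS s / N) := by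
        field_simp
      have h3 : 0 ≤ w f s (e f s) / pS s := div_nonneg (hw0 _ _ _) h0.le
      have h4 : w f s (e f s) / pS s ≤ 1 := (div_le_one h0).2 (hwle _ _ _)
      have h5 : pS s / N ≤ J + |J - pS s / N| := by linarith [neg_abs_le (J - pS s / N)]
      rw [h2, mul_comm J, mul_div_right_comm]
      nlinarith [mul_le_mul_of_nonneg_left h5 h3, abs_nonneg (J - pS s / N)]
  have hideal : ∑ f, ∑ s, ∑ x, xs (x, s) * (if φ x = f then 1 else 0) * w f s x / pS s =
      prob P (fun ω => bad (φ (X ω)) (X ω) (T ω)) := by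
    have h1 : ∀ s, ∑ f, ∑ x, xs (x, s) * (if φ x = f then 1 else 0) * w f s x / pS s =
        ∑ x, xs (x, s) * w (φ x) s x / pS s := by
      intro s
      rw [Finset.sum_comm]
      refine Finset.sum_congr rfl fun x _ => ?_
      rw [Finset.sum_eq_single (φ x)]
      · simp
      · intro f _ hf; simp [hf.symm]
      · simp
    rw [Finset.sum_comm]
    simp_rw [h1]
    have h2 : ∀ s x, xs (x, s) * w (φ x) s x / pS s = ∑ t, if σ t = s then
        (if bad (φ x) x t then push P (fun ω => (X ω, T ω)) (x, t) else 0) else 0 := by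
      intro s x
      rw [hw, Finset.mul_sum, Finset.sum_div]
      refine Finset.sum_congr rfl fun t _ => ?_
      rw [← hxt]
      split_ifs with a b
      · rw [a]
      · simp
      · simp
    simp_rw [h2]
    rw [Finset.sum_comm]
    have h3 : ∀ x, ∑ s, ∑ t, (if σ t = s then
        (if bad (φ x) x t then push P (fun ω => (X ω, T ω)) (x, t) else 0) else 0) =
        ∑ t, (if bad (φ x) x t then push P (fun ω => (X ω, T ω)) (x, t) else 0) := by
      intro x
      rw [Finset.sum_comm]
      exact Finset.sum_congr rfl fun t _ => by simp
    simp_rw [h3]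
    rw [← Fintype.sum_prod_type (f := fun u : α × γ =>
      if bad (φ u.1) u.1 u.2 then push P (fun ω => (X ω, T ω)) u else 0)]
    have := sum_push_mul (P := P) (fun ω => (X ω, T ω))
      (fun u => if bad (φ u.1) u.1 u.2 then 1 else 0)
    simpa [prob] using this
  have hsum : ∑ f, unif ζ f * ∑ s, w f s (e f s) ≤
      prob P (fun ω => bad (φ (X ω)) (X ω) (T ω)) +
        disc P (fun ω => φ (X ω)) (fun ω => σ (T ω)) := by
    rw [← hideal, disc, add_comm, ← Finset.sum_add_distrib]
    refine Finset.sum_le_sum fun f _ => ?_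
    rw [← Finset.sum_add_distrib, Finset.mul_sum]
    refine Finset.sum_le_sum fun s _ => ?_
    rw [unif, ← hN, mul_comm, ← div_eq_mul_inv]
    exact hterm f s
  obtain ⟨f, hf⟩ := exists_le_of_expVal_le (isPMF_unif ζ) hsum
  refine ⟨f, e f, le_trans (le_of_eq ?_) hf⟩
  simp only [hw, prob]
  rw [Finset.sum_comm]
  refine Finset.sum_congr rfl fun t _ => ?_
  simp

/-- Splitting a message: part of the second message is carried by the first link. -/
lemma exists_message_split {μ ν : Type*} [Fintype μ] [Fintype ν] [Nonempty μ] [Nonempty ν]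
    {t₁ t₂ L₁ L₂ : ℕ} (hν : Fintype.card ν ≤ 2 ^ (t₁ + t₂))
    (h₁ : Fintype.card μ * 2 ^ t₁ ≤ L₁) (h₂ : 2 ^ t₂ ≤ L₂) :
    ∃ (enc₁ : μ → ν → Fin L₁) (enc₂ : ν → Fin L₂) (dec₁ : Fin L₁ → μ)
      (dec₂ : Fin L₁ → Fin L₂ → ν), ∀ m l, dec₁ (enc₁ m l) = m ∧ dec₂ (enc₁ m l) (enc₂ l) = l := by
  obtain ⟨j⟩ : Nonempty (ν ↪ Fin (2 ^ t₁) × Fin (2 ^ t₂)) :=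
    Function.Embedding.nonempty_of_card_le (by simpa [pow_add] using hν)
  obtain ⟨i₁⟩ : Nonempty (μ × Fin (2 ^ t₁) ↪ Fin L₁) :=
    Function.Embedding.nonempty_of_card_le (by simpa using h₁)
  obtain ⟨i₂⟩ : Nonempty (Fin (2 ^ t₂) ↪ Fin L₂) :=
    Function.Embedding.nonempty_of_card_le (by simpa using h₂)
  refine ⟨fun m l => i₁ (m, (j l).1), fun l => i₂ (j l).2, fun a => (Function.invFun i₁ a).1,
    fun a b => Function.invFun j ((Function.invFun i₁ a).2, Function.invFun i₂ b),
    fun m l => ⟨?_, ?_⟩⟩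
  · exact congrArg Prod.fst (Function.leftInverse_invFun i₁.injective _)
  · simp only [Function.leftInverse_invFun i₁.injective _,
      Function.leftInverse_invFun i₂.injective _]
    exact Function.leftInverse_invFun j.injective l

section Degenerate

variable [Fintype Ω] {P : Ω → ℝ}

lemma markovChain_const_left (c : α) (Y : Ω → β) (Z : Ω → γ) :
    MarkovChain P (fun _ => c) Y Z := by
  intro x y z
  by_cases hx : c = x
  · subst hx
    rw [push_injective_comp (fun ω => (Z ω, Y ω)) (e := fun u : γ × β => (c, u.2, u.1))
      (fun a b h => by grind) (z, y), push_injective_comp Y (e := fun u : β => (c, u))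
      (fun a b h => by grind) y, mul_comm]
  · simp [push, hx]

lemma condMI_const_right [Fintype α] [Fintype β] [Fintype γ] (X : Ω → α) (c : β) (Z : Ω → γ) :
    condMI P X (fun _ => c) Z = 0 := by
  have h1 := entRV_injective_comp P Z (e := fun z : γ => (c, z)) (fun a b h => by grind)
  have h2 := entRV_injective_comp P (fun ω => (X ω, Z ω)) (e := fun z : α × γ => (z.1, c, z.2))
    (fun a b h => by grind)
  simp only at h1 h2
  rw [condMI, h1, h2]
  ring

lemma condMI_injective_comp_right {β' : Type*} [Fintype α] [Fintype β] [Fintype β'] [Fintype γ]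
    (X : Ω → α) (Y : Ω → β) (Z : Ω → γ) {e : β → β'} (he : Function.Injective e) :
    condMI P X (fun ω => e (Y ω)) Z = condMI P X Y Z := by
  have h1 := entRV_injective_comp P (fun ω => (Y ω, Z ω)) (e := fun z : β × γ => (e z.1, z.2))
    (fun a b h => Prod.ext (he (Prod.ext_iff.1 h).1) (Prod.ext_iff.1 h).2)
  have h2 := entRV_injective_comp P (fun ω => (X ω, Y ω, Z ω))
    (e := fun z : α × β × γ => (z.1, e z.2.1, z.2.2))
    (fun a b h => by
      simp only [Prod.ext_iff] at h
      exact Prod.ext h.1 (Prod.ext (he h.2.1) h.2.2))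
  simp only at h1 h2
  rw [condMI, condMI, h1, h2]

lemma entRV_push [Fintype α] [Fintype β] (X : Ω → α) (g : α → β) :
    entRV (push P X) g = entRV P (fun ω => g (X ω)) := by
  rw [entRV, entRV, push_comp]

lemma condMI_push {α' : Type*} [Fintype α'] [Fintype α] [Fintype β] [Fintype γ] (T : Ω → α')
    (X : α' → α) (Y : α' → β) (Z : α' → γ) :
    condMI (push P T) X Y Z =
      condMI P (fun ω => X (T ω)) (fun ω => Y (T ω)) (fun ω => Z (T ω)) := by
  simp only [condMI, entRV_push]

lemma markovChain_push {α' : Type*} [Fintype α'] {T : Ω → α'}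
    {X : α' → α} {Y : α' → β} {Z : α' → γ}
    (h : MarkovChain P (fun ω => X (T ω)) (fun ω => Y (T ω)) (fun ω => Z (T ω))) :
    MarkovChain (push P T) X Y Z := by
  intro x y z
  simpa only [push_comp] using h x y z

end Degenerate

/-- Padding the two alphabets of a joint pmf by isolated vertices preserves Gács–Körner maps. -/
lemma IsGKMap.pad {α' β' : Type*} {p : α × β → ℝ} {p' : α' × β' → ℝ} {g : β → β} {ι : β → β'}
    {κ : β' → Option β} (hκ : ∀ y, κ (ι y) = some y) (hι : ∀ y y', κ y' = some y → ι y = y')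
    (hstep : ∀ y₁ y₂, GKStep p' (ι y₁) (ι y₂) ↔ GKStep p y₁ y₂)
    (hiso : ∀ y₁ y₂, GKStep p' y₁ y₂ → κ y₁ ≠ none ∧ κ y₂ ≠ none) (hg : IsGKMap p g) :
    IsGKMap p' (fun y' => (κ y').elim y' fun y => ι (g y)) := by
  have hinj : Function.Injective ι := fun a b h => by
    have := congrArg κ h
    simpa [hκ] using this
  have hconn : ∀ y₁ y₂, GKConn p' (ι y₁) (ι y₂) ↔ GKConn p y₁ y₂ := by
    intro y₁ y₂
    constructor
    · have : ∀ z, GKConn p' (ι y₁) z → ∀ y, z = ι y → GKConn p y₁ y := by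
        intro z hz
        induction hz with
        | refl => intro y hy; rw [hinj hy]; exact Relation.ReflTransGen.refl
        | tail hb hs ih =>
          rename_i b c
          rintro y rfl
          obtain ⟨b', hb'⟩ := Option.ne_none_iff_exists'.1 (hiso _ _ hs).1
          obtain rfl := hι _ _ hb'
          exact (ih b' rfl).tail ((hstep _ _).1 hs)
      exact fun h => this _ h _ rfl
    · exact fun h => h.lift ι fun a b hab => (hstep a b).2 hab
  have hnone : ∀ y z, κ y = none ∨ κ z = none → GKConn p' y z → y = z := by
    intro y z hyz h
    rcases hyz with hy | hz
    · rcases Relation.ReflTransGen.cases_head h with h | ⟨c, hc, -⟩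
      · exact h
      · exact absurd hy (hiso _ _ hc).1
    · rcases Relation.ReflTransGen.cases_tail h with h | ⟨c, -, hc⟩
      · exact h.symm
      · exact absurd hz (hiso _ _ hc).2
  intro y z
  change ((κ y).elim y fun y => ι (g y)) = ((κ z).elim z fun y => ι (g y)) ↔ _
  rcases hy : κ y with _ | y₀ <;> rcases hz : κ z with _ | z₀
  · exact ⟨fun h => (show y = z from h) ▸ Relation.ReflTransGen.refl, hnone y z (Or.inl hy)⟩
  · refine ⟨fun h : y = ι (g z₀) => ?_, fun h => ?_⟩
    · rw [h, hκ] at hy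
      exact absurd hy (Option.some_ne_none _)
    · rw [hnone y z (Or.inl hy) h, hz] at hy
      exact absurd hy (Option.some_ne_none _)
  · refine ⟨fun h : ι (g y₀) = z => ?_, fun h => ?_⟩
    · rw [← h, hκ] at hz
      exact absurd hz (Option.some_ne_none _)
    · rw [← hnone y z (Or.inr hz) h, hy] at hz
      exact absurd hz (Option.some_ne_none _)
  · obtain rfl := hι _ _ hy
    obtain rfl := hι _ _ hz
    rw [Option.elim_some, Option.elim_some, hconn, ← hg, hinj.eq_iff]

section Inclusion

variable {S U V W : Type*} [Fintype S] [Fintype U] [Fintype V]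

lemma RStar_subset_RDag (p : S × U × V → ℝ) (d : S → W → ℝ) (D : ℝ) (k : ℕ) :
    RStar p d D k ⊆ RDag p d D k := by
  rintro r ⟨hr1, hr2, q, ⟨hq, hpq, hM, g, f, hg, hD⟩, h1, h2⟩
  obtain ⟨ω₀, -⟩ := hq.exists_pos
  have : NeZero k := ⟨fun h => by subst h; exact Fin.elim0 ω₀.1⟩
  set T : Fin k × S × U × V → (Fin k × Fin k × Fin k) × S × U × V :=
    fun x => ((x.1, 0, 0), x.2) with hT
  set κ : Fin k × Fin k × V → Option (Fin k × V) :=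
    fun y => if y.2.1 = 0 then some (y.1, y.2.2) else none with hκ
  set ι : Fin k × V → Fin k × Fin k × V := fun y => (y.1, 0, y.2) with hι
  have hκι : ∀ y, κ (ι y) = some y := fun y => by simp [hκ, hι]
  refine ⟨hr1, hr2, push q T, ⟨⟨isPMF_push hq T, ?_, ?_, fun y' => (κ y').elim y' fun y => ι (g y),
    fun y => f (y.1, y.2.2), ?_, ?_⟩, ?_⟩, ?_, ?_⟩
  · intro y
    rw [push_comp, ← hpq]
  · exact markovChain_push (hM.comp (fun a => (a, (0 : Fin k), (0 : Fin k))) id)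
  · rw [push_comp]
    set p₀ := push q fun x => ((x.1, x.2.2.1), (x.1, x.2.2.2)) with hp₀
    have hval : ∀ x y, push q (fun x => (((T x).1.1, (T x).1.2.1, (T x).2.2.1),
        ((T x).1.1, (T x).1.2.2, (T x).2.2.2))) ((x.1, 0, x.2), ι y) = p₀ (x, y) := by
      intro x y
      rw [hp₀, ← push_injective_comp
        (fun x : Fin k × S × U × V => ((x.1, x.2.2.1), (x.1, x.2.2.2)))
        (e := fun u : (Fin k × U) × Fin k × V => ((u.1.1, (0 : Fin k), u.1.2), ι u.2))
        (fun a b h => by simp only [hι, Prod.ext_iff] at h ⊢; tauto) (x, y)]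
    have hzero : ∀ x y, 0 < push q (fun x => (((T x).1.1, (T x).1.2.1, (T x).2.2.1),
        ((T x).1.1, (T x).1.2.2, (T x).2.2.2))) (x, y) → x.2.1 = 0 ∧ y.2.1 = 0 := by
      intro x y h
      by_contra hne
      refine h.ne' (Finset.sum_eq_zero fun z _ => if_neg fun hz => hne ?_)
      simp only [hT, Prod.ext_iff] at hz
      exact ⟨hz.1.2.1.symm, hz.2.2.1.symm⟩
    refine IsGKMap.pad hκι ?_ ?_ ?_ hg
    · intro y y' h
      simp only [hκ, Option.ite_none_right_eq_some, Option.some.injEq] at h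
      obtain ⟨h0, rfl⟩ := h
      simp [hι, ← h0]
    · intro y₁ y₂
      constructor
      · rintro ⟨x, hx1, hx2⟩
        obtain ⟨a, b, c⟩ := x
        obtain rfl : b = 0 := (hzero _ _ hx1).1
        exact ⟨(a, c), (hval (a, c) y₁) ▸ hx1, (hval (a, c) y₂) ▸ hx2⟩
      · rintro ⟨x, hx1, hx2⟩
        exact ⟨(x.1, 0, x.2), (hval x y₁).symm ▸ hx1, (hval x y₂).symm ▸ hx2⟩
    · rintro y₁ y₂ ⟨x, hx1, hx2⟩
      simp [hκ, (hzero _ _ hx1).2, (hzero _ _ hx2).2]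
  · refine le_trans (le_of_eq ?_) hD
    rw [expVal, sum_push_mul]
    refine Finset.sum_congr rfl fun x _ => ?_
    simp [hT, hκ, hι]
  · exact markovChain_push (markovChain_const_left _ _ _)
  · rw [condMI_push]
    refine le_trans (le_of_eq ?_) h1
    exact condMI_injective_comp_right _ _ _ (e := fun a : Fin k => (a, (0 : Fin k)))
      (fun a b h => (Prod.ext_iff.1 h).1)
  · simp only [condMI_push, hT, condMI_const_right, add_zero]
    exact max_le (h1.trans (by linarith)) h2

end Inclusion

section Chains

variable [Fintype Ω] {P : Ω → ℝ} {X : Ω → α} {Y : Ω → β} {Z : Ω → γ}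

lemma MarkovChain.prod_right (h : MarkovChain P X Y Z) :
    MarkovChain P X Y (fun ω => (Y ω, Z ω)) := by
  rintro x y ⟨y', z⟩
  by_cases hy : y' = y
  · subst hy
    have h1 := push_injective_comp (P := P) (fun ω => (X ω, Y ω, Z ω))
      (e := fun u : α × β × γ => (u.1, u.2.1, u.2)) (fun a b hab => by grind) (x, y', z)
    have h2 := push_injective_comp (P := P) (fun ω => (Z ω, Y ω))
      (e := fun u : γ × β => ((u.2, u.1), u.2)) (fun a b hab => by grind) (z, y')
    simp only at h1 h2
    rw [h1, h2, h]
  · have h1 : push P (fun ω => (X ω, Y ω, Y ω, Z ω)) (x, y, y', z) = 0 :=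
      Finset.sum_eq_zero fun ω _ => if_neg fun hω => hy (by grind)
    have h2 : push P (fun ω => ((Y ω, Z ω), Y ω)) ((y', z), y) = 0 :=
      Finset.sum_eq_zero fun ω _ => if_neg fun hω => hy (by grind)
    rw [h1, h2, zero_mul, mul_zero]

lemma markovChain_iid {ι : Type*} [Fintype ι] [DecidableEq ι] [Fintype α] [Fintype β] [Fintype γ]
    (h : MarkovChain P X Y Z) :
    MarkovChain (iid P) (fun (ω : ι → Ω) i => X (ω i)) (fun ω i => Y (ω i))
      (fun ω i => Z (ω i)) := by
  intro x y z
  have h3 : push (iid P) (fun ω : ι → Ω =>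
      ((fun i => X (ω i)), (fun i => Y (ω i)), fun i => Z (ω i))) (x, y, z) =
      ∏ i, push P (fun ω => (X ω, Y ω, Z ω)) (x i, y i, z i) := by
    rw [← push_iid (fun ω => (X ω, Y ω, Z ω)) (fun i => (x i, y i, z i)),
      ← push_injective_comp (fun (ω : ι → Ω) i => (X (ω i), Y (ω i), Z (ω i)))
        (e := fun u : ι → α × β × γ => ((fun i => (u i).1), (fun i => (u i).2.1),
          fun i => (u i).2.2))
        (fun a b hab => by
          simp only [Prod.ext_iff, funext_iff] at hab
          funext i
          exact Prod.ext (hab.1 i) (Prod.ext (hab.2.1 i) (hab.2.2 i)))]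
  rw [h3, push_iid, push_iid_pair, push_iid_pair, ← Finset.prod_mul_distrib,
    ← Finset.prod_mul_distrib]
  exact Finset.prod_congr rfl fun i _ => h _ _ _

variable [Fintype α] [Fintype β] [Fintype γ]

lemma MarkovChain.condMI_eq (hP : ∀ ω, 0 ≤ P ω) (h : MarkovChain P X Y Z) :
    condMI P Y X Z = condEntRV P X Z - condEntRV P X Y := by
  have h1 := h.entRV_add hP
  have h2 := entRV_injective_comp P (fun ω => (X ω, Y ω, Z ω))
    (e := fun u : α × β × γ => (u.2.1, u.1, u.2.2)) (fun a b hab => by grind)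
  have h3 := entRV_injective_comp P (fun ω => (Z ω, Y ω))
    (e := fun u : γ × β => (u.2, u.1)) (fun a b hab => by grind)
  simp only at h2 h3
  rw [condMI, condEntRV, condEntRV]
  linarith

lemma MarkovChain.condEntRV_eq (hP : ∀ ω, 0 ≤ P ω) (h : MarkovChain P X Y Z) :
    condEntRV P Z (fun ω => (X ω, Y ω)) = condEntRV P Z Y := by
  have h1 := h.entRV_add hP
  have h2 := entRV_injective_comp P (fun ω => (X ω, Y ω, Z ω))
    (e := fun u : α × β × γ => (u.2.2, u.1, u.2.1)) (fun a b hab => by grind)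
  simp only at h2
  rw [condEntRV, condEntRV]
  linarith

lemma condMI_chain {δ : Type*} [Fintype δ] (X : Ω → α) (A : Ω → β) (B : Ω → γ) (U : Ω → δ) :
    condMI P X (fun ω => (A ω, B ω)) U =
      condMI P X A U + condMI P X B (fun ω => (A ω, U ω)) := by
  have h1 := entRV_injective_comp P (fun ω => ((A ω, B ω), U ω))
    (e := fun u : (β × γ) × δ => (u.1.2, u.1.1, u.2)) (fun a b hab => by grind)
  have h2 := entRV_injective_comp P (fun ω => (X ω, (A ω, B ω), U ω))
    (e := fun u : α × (β × γ) × δ => (u.1, u.2.1.2, u.2.1.1, u.2.2)) (fun a b hab => by grind)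
  simp only at h1 h2
  simp only [condMI]
  linarith

lemma MarkovChain.condMI_eq_of_prod {α' : Type*} [Fintype α'] {X' : Ω → α'}
    (hP : ∀ ω, 0 ≤ P ω) (h : MarkovChain P (fun ω => (X ω, X' ω)) Y Z) :
    condMI P Y X' (fun ω => (X ω, Z ω)) =
      condEntRV P X' (fun ω => (X ω, Z ω)) - condEntRV P X' (fun ω => (X ω, Y ω)) := by
  have h1 := h.condMI_eq hP
  have h2 := (h.comp Prod.fst id).condMI_eq hP
  have h3 := entRV_injective_comp P (fun ω => ((X ω, X' ω), Y ω))
    (e := fun u : (α × α') × β => (u.1.2, u.1.1, u.2)) (fun a b hab => by grind)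
  have h4 := entRV_injective_comp P (fun ω => ((X ω, X' ω), Z ω))
    (e := fun u : (α × α') × γ => (u.1.2, u.1.1, u.2)) (fun a b hab => by grind)
  simp only [id_eq] at h2 h3 h4
  rw [condMI_chain, h2] at h1
  simp only [condEntRV] at h1 ⊢
  linarith

end Chains

/-- A function of the common randomness can be computed from the other side. -/
lemma IsGKMap.exists_left [Nonempty γ] {p : α × β → ℝ} {g : β → β} (hg : IsGKMap p g)
    (f : β → γ) : ∃ fl : α → γ, ∀ x y, 0 < p (x, y) → fl x = f (g y) := by
  have : ∀ x, ∃ c, ∀ y, 0 < p (x, y) → c = f (g y) := by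
    intro x
    by_cases h : ∃ y₀, 0 < p (x, y₀)
    · obtain ⟨y₀, h₀⟩ := h
      exact ⟨f (g y₀), fun y hy => congrArg f ((hg _ _).2 (.single ⟨x, h₀, hy⟩))⟩
    · exact ⟨Classical.arbitrary γ, fun y hy => absurd ⟨y, hy⟩ h⟩
  exact ⟨fun x => (this x).choose, fun x => (this x).choose_spec⟩

/-- One block of the random binning code, with the common bin index and the encoder fixed. -/
lemma exists_block_code {A B C S U V W : Type*} [Fintype A] [Fintype B] [Fintype C] [Fintype S]
    [Fintype U] [Fintype V] [Nonempty W] {p : S × U × V → ℝ} {q : (A × B × C) × S × U × V → ℝ}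
    (hq : IsPMF q) (hpq : ∀ y, push q (fun x => x.2) y = p y)
    (hM : MarkovChain q (fun x => x.1) (fun x => x.2.1) (fun x => x.2.2))
    (hBC : MarkovChain q (fun x => x.1.2.1) (fun x => (x.1.1, x.2.1)) (fun x => x.1.2.2))
    {g : A × C × V → A × C × V} (f : A × C × V → W)
    (hg : IsGKMap (push q (fun x => ((x.1.1, x.1.2.1, x.2.2.1), (x.1.1, x.1.2.2, x.2.2.2)))) g)
    (d : S → W → ℝ) {D : ℝ} (hD : expVal q (fun x => d x.2.1 (f (g (x.1.1, x.1.2.2, x.2.2.2)))) ≤ D)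
    {δ η : ℝ} (hδ : 0 < δ) (hη : 0 < η) :
    ∃ N : ℕ, ∀ n ≥ N, ∀ (FA FB FC MA MB MC LA : ℕ) [NeZero FA] [NeZero FB] [NeZero FC]
      [NeZero MA] [NeZero MB] [NeZero MC] [NeZero LA],
      (FA : ℝ) - 1 ≤ 2 ^ (n * (condEntRV q (fun x => x.1.1) (fun x => x.2.1) - δ)) →
      (FB : ℝ) - 1 ≤
        2 ^ (n * (condEntRV q (fun x => x.1.2.1) (fun x => (x.1.1, x.2.1)) - δ)) →
      (FC : ℝ) - 1 ≤
        2 ^ (n * (condEntRV q (fun x => x.1.2.2) (fun x => (x.1.1, x.2.1)) - δ)) →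
      2 ^ (n * (condEntRV q (fun x => x.1.1) (fun x => x.2.2.1) + δ)) ≤ (FA * MA : ℝ) →
      2 ^ (n * (condEntRV q (fun x => x.1.1) (fun x => x.2.2.2) + δ)) ≤ (FA * MA * LA : ℝ) →
      2 ^ (n * (condEntRV q (fun x => x.1.2.1) (fun x => (x.1.1, x.2.2.1)) + δ)) ≤
        (FB * MB : ℝ) →
      2 ^ (n * (condEntRV q (fun x => x.1.2.2) (fun x => (x.1.1, x.2.2.2)) + δ)) ≤
        (FC * MC : ℝ) →
      ∃ (m : (Fin n → S) → Fin MA × Fin MB) (l : (Fin n → S) → Fin LA × Fin MC)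
        (Du : Fin MA × Fin MB → (Fin n → U) → Fin n → W)
        (Dv : Fin MA × Fin MB → Fin LA × Fin MC → (Fin n → V) → Fin n → W),
        prob (iid p) (fun t : Fin n → S × U × V =>
          ¬ (Du (m fun i => (t i).1) (fun i => (t i).2.1) =
              Dv (m fun i => (t i).1) (l fun i => (t i).1) (fun i => (t i).2.2) ∧
            ∑ i, d (t i).1 (Du (m fun i => (t i).1) (fun i => (t i).2.1) i) ≤ n * (D + δ)))
          ≤ 8 * η := by
  obtain ⟨N₁, h₁⟩ := exists_binning hq (fun x => x.1.1) (fun x => x.2.1) (fun x => x.2.2.1)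
    (fun x => x.2.2.2) hδ hη
  obtain ⟨N₂, h₂⟩ := exists_binning hq (fun x => x.1.2.1) (fun x => (x.1.1, x.2.1))
    (fun x => (x.1.1, x.2.2.1)) (fun x => (x.1.1, x.2.2.1)) hδ hη
  obtain ⟨N₃, h₃⟩ := exists_binning hq (fun x => x.1.2.2) (fun x => (x.1.2.1, (x.1.1, x.2.1)))
    (fun x => (x.1.1, x.2.2.2)) (fun x => (x.1.1, x.2.2.2)) hδ hη
  obtain ⟨N₄, h₄⟩ := prob_iid_deviation_le hq
    (fun x => d x.2.1 (f (g (x.1.1, x.1.2.2, x.2.2.2)))) hδ hη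
  obtain ⟨fl, hfl⟩ := hg.exists_left f
  refine ⟨max (max N₁ N₂) (max N₃ N₄), fun n hn FA FB FC MA MB MC LA _ _ _ _ _ _ _
    hFA hFB hFC hMA hLA hMB hMC => ?_⟩
  rw [ge_iff_le, max_le_iff, max_le_iff, max_le_iff] at hn
  obtain ⟨φA, decAU, decAV, hdA, heAU, heAV⟩ := h₁ n hn.1.1 FA MA LA (NeZero.pos _)
    (NeZero.pos _) (NeZero.pos _) hFA hMA hLA
  obtain ⟨φB, decB, -, hdB, heB, -⟩ := h₂ n hn.1.2 FB MB 1 (NeZero.pos _)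
    (NeZero.pos _) one_pos hFB hMB (by simpa using hMB)
  obtain ⟨φC, decC, -, hdC, heC, -⟩ := h₃ n hn.2.1 FC MC 1 (NeZero.pos _)
    (NeZero.pos _) one_pos (by rwa [hBC.condEntRV_eq hq.1]) hMC (by simpa using hMC)
  specialize h₄ n hn.2.2
  have hP : IsPMF (iid q : (Fin n → (A × B × C) × S × U × V) → ℝ) := isPMF_iid hq
  obtain ⟨ω₀, -⟩ := hP.exists_pos
  have : Nonempty (Fin n → A × B × C) := ⟨fun i => (ω₀ i).1⟩
  set φ : (Fin n → A × B × C) → Fin FA × Fin FB × Fin FC := fun x =>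
    ((φA fun i => (x i).1).1, (φB fun i => (x i).2.1).1, (φC fun i => (x i).2.2).1) with hφ
  set m : (Fin n → A × B × C) → Fin MA × Fin MB := fun x =>
    ((φA fun i => (x i).1).2.1, (φB fun i => (x i).2.1).2.1) with hm
  set l : (Fin n → A × B × C) → Fin LA × Fin MC := fun x =>
    ((φA fun i => (x i).1).2.2, (φC fun i => (x i).2.2).2.1) with hl
  set Du : Fin FA × Fin FB × Fin FC → Fin MA × Fin MB → (Fin n → U) → Fin n → W := fun z m u i =>
    fl (decAU (z.1, m.1) u i,
      decB (z.2.1, m.2) (fun i => (decAU (z.1, m.1) u i, u i)) i, u i) with hDu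
  set Dv : Fin FA × Fin FB × Fin FC → Fin MA × Fin MB → Fin LA × Fin MC → (Fin n → V) → Fin n → W :=
    fun z m l v i => f (g (decAV (z.1, m.1, l.1) v i,
      decC (z.2.2, l.2) (fun i => (decAV (z.1, m.1, l.1) v i, v i)) i, v i)) with hDv
  have hpT : push (iid q) (fun (ω : Fin n → (A × B × C) × S × U × V) i => (ω i).2) = iid p := by
    funext t
    rw [push_iid]
    exact Finset.prod_congr rfl fun i _ => hpq _
  obtain ⟨z, e, hze⟩ := exists_deterministic_encoder hP (fun ω i => (ω i).1) (fun ω i => (ω i).2)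
    (fun t i => (t i).1) (markovChain_iid hM.prod_right) φ
    (fun z x t => ¬ (Du z (m x) (fun i => (t i).2.1) = Dv z (m x) (l x) (fun i => (t i).2.2) ∧
      ∑ i, d (t i).1 (Du z (m x) (fun i => (t i).2.1) i) ≤ n * (D + δ)))
  rw [hpT] at hze
  refine ⟨fun s => m (e s), fun s => l (e s), Du z, Dv z, hze.trans ?_⟩
  have hdisc : disc (iid q) (fun ω : Fin n → (A × B × C) × S × U × V => φ fun i => (ω i).1)
      (fun ω i => (ω i).2.1) ≤ η + η + η := by
    refine (disc_prod_le _ _ _ _).trans (add_le_add ?_ hdA)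
    refine (disc_prod_le _ _ _ _).trans (add_le_add ?_ ?_)
    · exact (disc_comp_le _ _ (fun (ω : Fin n → (A × B × C) × S × U × V) i =>
        ((ω i).1.2.1, ((ω i).1.1, (ω i).2.1))) (fun y => ((φB fun i => (y i).1).1,
          (φA fun i => (y i).2.1).1, fun i => (y i).2.2))).trans hdC
    · exact (disc_comp_le _ _ (fun (ω : Fin n → (A × B × C) × S × U × V) i =>
        ((ω i).1.1, (ω i).2.1)) (fun y => ((φA fun i => (y i).1).1, fun i => (y i).2))).trans hdB
  have hor : ∀ E F : (Fin n → (A × B × C) × S × U × V) → Prop, ∀ a b, prob (iid q) E ≤ a →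
      prob (iid q) F ≤ b → prob (iid q) (fun ω => E ω ∨ F ω) ≤ a + b :=
    fun E F a b hE hF => (prob_or_le hP.1 E F).trans (add_le_add hE hF)
  have hall := hor _ _ _ _ (hor _ _ _ _ heAU heAV) (hor _ _ _ _ (hor _ _ _ _ heB heC) h₄)
  have hideal := (prob_mono hP.1 (fun ω hω (hbad : ¬ (Du (φ fun i => (ω i).1) (m fun i => (ω i).1)
      (fun i => (ω i).2.2.1) = Dv (φ fun i => (ω i).1) (m fun i => (ω i).1) (l fun i => (ω i).1)
        (fun i => (ω i).2.2.2) ∧ ∑ i, d (ω i).2.1 (Du (φ fun i => (ω i).1) (m fun i => (ω i).1)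
          (fun i => (ω i).2.2.1) i) ≤ n * (D + δ))) => by
    by_contra hgood
    simp only [not_or, not_not, not_le] at hgood
    obtain ⟨⟨hAU, hAV⟩, ⟨hB, hC⟩, hL⟩ := hgood
    have hDu' : Du (φ fun i => (ω i).1) (m fun i => (ω i).1) (fun i => (ω i).2.2.1) =
        fun i => fl ((ω i).1.1, (ω i).1.2.1, (ω i).2.2.1) := by
      simp only [hDu, hφ, hm, hAU, hB]
    have hDv' : Dv (φ fun i => (ω i).1) (m fun i => (ω i).1) (l fun i => (ω i).1)
        (fun i => (ω i).2.2.2) = fun i => f (g ((ω i).1.1, (ω i).1.2.2, (ω i).2.2.2)) := by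
      simp only [hDv, hφ, hm, hl, hAV, hC]
    have heq : ∀ i, fl ((ω i).1.1, (ω i).1.2.1, (ω i).2.2.1) =
        f (g ((ω i).1.1, (ω i).1.2.2, (ω i).2.2.2)) := fun i =>
      hfl _ _ (push_pos hq.1 (fun x : (A × B × C) × S × U × V =>
        ((x.1.1, x.1.2.1, x.2.2.1), (x.1.1, x.1.2.2, x.2.2.2))) (pos_of_iid_pos hq.1 hω i))
    refine hbad ⟨by rw [hDu', hDv']; exact funext heq, ?_⟩
    rw [hDu']
    simp only [heq]
    have := (abs_lt.1 hL).2
    nlinarith [mul_le_mul_of_nonneg_left hD (Nat.cast_nonneg (α := ℝ) n)])).trans hall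
  linarith [hideal, hdisc]

lemma two_pow_floor_sub_one_le (x : ℝ) : (((2 ^ ⌊x⌋₊ : ℕ) : ℝ)) - 1 ≤ 2 ^ x := by
  push_cast
  rcases le_or_gt 0 x with hx | hx
  · have : (2 : ℝ) ^ ⌊x⌋₊ ≤ 2 ^ x := by
      rw [← Real.rpow_natCast]
      exact Real.rpow_le_rpow_of_exponent_le one_le_two (Nat.floor_le hx)
    linarith
  · rw [Nat.floor_of_nonpos hx.le, pow_zero, sub_self]
    positivity

lemma two_rpow_le_two_pow {x : ℝ} {k : ℕ} (h : x ≤ k) : (2 : ℝ) ^ x ≤ 2 ^ k := by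
  rw [← Real.rpow_natCast]
  exact Real.rpow_le_rpow_of_exponent_le one_le_two h

lemma two_pow_le_ceil {x : ℝ} {k : ℕ} (h : (k : ℝ) ≤ x) : 2 ^ k ≤ ⌈(2 : ℝ) ^ x⌉₊ := by
  have : ((2 ^ k : ℕ) : ℝ) ≤ 2 ^ x := by
    push_cast
    rw [← Real.rpow_natCast]
    exact Real.rpow_le_rpow_of_exponent_le one_le_two h
  exact_mod_cast this.trans (Nat.le_ceil _)

lemma ceil_sub_floor_le {x y : ℝ} (hx : 0 ≤ x) (hyx : y ≤ x) :
    ((⌈x⌉₊ - ⌊y⌋₊ : ℕ) : ℝ) ≤ x - y + 2 := by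
  rcases le_total ⌊y⌋₊ ⌈x⌉₊ with h | h
  · rw [Nat.cast_sub h]
    linarith [Nat.ceil_lt_add_one hx, Nat.lt_floor_add_one y]
  · rw [Nat.sub_eq_zero_of_le h, Nat.cast_zero]
    linarith

/-- The choice of the bin sizes. -/
lemma exists_bin_sizes {aS aU aV bS bU cS cV r₁ r₂ ε : ℝ} (haS : 0 ≤ aS) (hbS : 0 ≤ bS)
    (hcS : 0 ≤ cS) (haU : aS ≤ aU) (haV : aS ≤ aV) (hbU : bS ≤ bU) (hcV : cS ≤ cV)
    (h₁ : (aU - aS) + (bU - bS) ≤ r₁)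
    (h₂ : max (aU - aS) (aV - aS) + (bU - bS) + (cV - cS) ≤ r₂ + r₁)
    (hr₂ : 0 ≤ r₂) (hε : 0 < ε) :
    ∃ N : ℕ, ∀ n ≥ N, ∃ fA fB fC mA mB mC lA t₁ t₂ : ℕ,
      ((2 ^ fA : ℕ) : ℝ) - 1 ≤ 2 ^ (n * (aS - ε / 6)) ∧
      ((2 ^ fB : ℕ) : ℝ) - 1 ≤ 2 ^ (n * (bS - ε / 6)) ∧
      ((2 ^ fC : ℕ) : ℝ) - 1 ≤ 2 ^ (n * (cS - ε / 6)) ∧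
      2 ^ (n * (aU + ε / 6)) ≤ ((2 ^ fA : ℕ) : ℝ) * (2 ^ mA : ℕ) ∧
      2 ^ (n * (aV + ε / 6)) ≤ ((2 ^ fA : ℕ) : ℝ) * (2 ^ mA : ℕ) * (2 ^ lA : ℕ) ∧
      2 ^ (n * (bU + ε / 6)) ≤ ((2 ^ fB : ℕ) : ℝ) * (2 ^ mB : ℕ) ∧
      2 ^ (n * (cV + ε / 6)) ≤ ((2 ^ fC : ℕ) : ℝ) * (2 ^ mC : ℕ) ∧
      lA + mC ≤ t₁ + t₂ ∧
      2 ^ (mA + mB + t₁) ≤ ⌈(2 : ℝ) ^ (n * (r₁ + ε))⌉₊ ∧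
      2 ^ t₂ ≤ ⌈(2 : ℝ) ^ (n * (r₂ + ε))⌉₊ := by
  refine ⟨⌈15 / ε⌉₊, fun n hn => ?_⟩
  have hn15 : 15 ≤ n * ε := by
    have := (Nat.le_ceil _).trans (Nat.cast_le (α := ℝ).2 hn)
    rwa [div_le_iff₀ hε] at this
  have hn0 : (0 : ℝ) ≤ n := Nat.cast_nonneg n
  have hbd : ∀ {s u : ℝ}, 0 ≤ s → s ≤ u →
      ((⌈n * (u + ε / 6)⌉₊ - ⌊n * (s - ε / 6)⌋₊ : ℕ) : ℝ) ≤ n * (u - s) + n * ε / 3 + 2 := by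
    intro s u hs hu
    have := ceil_sub_floor_le (x := n * (u + ε / 6)) (y := n * (s - ε / 6))
      (mul_nonneg hn0 (by linarith)) (mul_le_mul_of_nonneg_left (by linarith) hn0)
    linarith
  have hcov : ∀ (x : ℝ) (k : ℕ), (2 : ℝ) ^ x ≤ ((2 ^ k : ℕ) : ℝ) * (2 ^ (⌈x⌉₊ - k) : ℕ) := by
    intro x k
    push_cast
    rw [← pow_add]
    refine two_rpow_le_two_pow ((Nat.le_ceil x).trans (Nat.cast_le.2 ?_))
    omega
  set fA := ⌊n * (aS - ε / 6)⌋₊ with hfA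
  set fB := ⌊n * (bS - ε / 6)⌋₊ with hfB
  set fC := ⌊n * (cS - ε / 6)⌋₊ with hfC
  set mA := ⌈n * (aU + ε / 6)⌉₊ - fA with hmA
  set mB := ⌈n * (bU + ε / 6)⌉₊ - fB with hmB
  set mC := ⌈n * (cV + ε / 6)⌉₊ - fC with hmC
  set lA := ⌈n * (aV + ε / 6)⌉₊ - (fA + mA) with hlA
  set k₁ := ⌊n * (r₁ + ε)⌋₊ with hk₁
  set k₂ := ⌊n * (r₂ + ε)⌋₊ with hk₂
  have hbA := hbd haS haU
  have hbB := hbd hbS hbU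
  have hbC := hbd hcS hcV
  have hbAV := hbd haS haV
  rw [← hfA, ← hmA] at hbA
  rw [← hfB, ← hmB] at hbB
  rw [← hfC, ← hmC] at hbC
  rw [← hfA] at hbAV
  have hbl : ((mA + lA : ℕ) : ℝ) ≤ n * max (aU - aS) (aV - aS) + n * ε / 3 + 2 := by
    have h3 := mul_le_mul_of_nonneg_left (le_max_left (aU - aS) (aV - aS)) hn0
    have h4 := mul_le_mul_of_nonneg_left (le_max_right (aU - aS) (aV - aS)) hn0
    rcases Nat.eq_zero_or_pos lA with h | h
    · rw [h, add_zero]; linarith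
    · have : mA + lA = ⌈n * (aV + ε / 6)⌉₊ - fA := by omega
      rw [this]; linarith
  push_cast at hbl
  have hk₁' := Nat.lt_floor_add_one (n * (r₁ + ε))
  have hk₂' := Nat.lt_floor_add_one (n * (r₂ + ε))
  rw [← hk₁] at hk₁'
  rw [← hk₂] at hk₂'
  have e₁ := mul_le_mul_of_nonneg_left h₁ hn0
  have e₂ := mul_le_mul_of_nonneg_left h₂ hn0
  have hle₁ : mA + mB ≤ k₁ := by
    have : ((mA + mB : ℕ) : ℝ) ≤ k₁ := by push_cast; linarith
    exact_mod_cast this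
  have hle₂ : mA + mB + (lA + mC) ≤ k₁ + k₂ := by
    have : ((mA + mB + (lA + mC) : ℕ) : ℝ) ≤ (k₁ + k₂ : ℕ) := by push_cast; linarith
    exact_mod_cast this
  refine ⟨fA, fB, fC, mA, mB, mC, lA, k₁ - (mA + mB), k₂, two_pow_floor_sub_one_le _,
    two_pow_floor_sub_one_le _, two_pow_floor_sub_one_le _, hcov _ _, ?_, hcov _ _, hcov _ _,
    by omega, ?_, ?_⟩
  · have := hcov (n * (aV + ε / 6)) (fA + mA)
    rw [← hlA] at this
    rwa [← Nat.cast_mul, ← pow_add]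
  · rw [Nat.add_sub_cancel' hle₁]
    exact two_pow_le_ceil (Nat.floor_le (mul_nonneg hn0 (by linarith)))
  · exact two_pow_le_ceil (Nat.floor_le (mul_nonneg hn0 (by linarith)))

lemma average_expVal_le [Fintype Ω] {P : Ω → ℝ} (hP : IsPMF P) {n : ℕ} (hn : 0 < n)
    {c : Ω → Fin n → ℝ} {M D' κ : ℝ} (hD' : 0 ≤ D') (hM : 0 ≤ M) (hc : ∀ ω i, c ω i ≤ M)
    {bad : Ω → Prop} (hbad : prob P bad ≤ κ) (hgood : ∀ ω, ¬ bad ω → ∑ i, c ω i ≤ n * D') :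
    (1 / (n : ℝ)) * ∑ i, expVal P (fun ω => c ω i) ≤ D' + M * κ := by
  have hn' : (0 : ℝ) < n := Nat.cast_pos.2 hn
  have hle : ∑ i, expVal P (fun ω => c ω i) ≤ n * (D' + M * prob P bad) := by
    have h1 : n * (D' + M * prob P bad) =
        ∑ ω, P ω * (n * D' + if bad ω then n * M else 0) := by
      simp only [mul_add, mul_ite, mul_zero, Finset.sum_add_distrib, ← Finset.sum_mul, hP.2, one_mul]
      rw [prob, Finset.mul_sum, Finset.mul_sum]
      refine congrArg _ (Finset.sum_congr rfl fun ω _ => ?_)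
      split_ifs <;> ring
    simp only [expVal]
    rw [h1, Finset.sum_comm]
    refine Finset.sum_le_sum fun ω _ => ?_
    rw [← Finset.mul_sum]
    refine mul_le_mul_of_nonneg_left ?_ (hP.1 ω)
    split_ifs with h
    · have : ∑ i, c ω i ≤ n * M := by
        simpa using Finset.sum_le_card_nsmul Finset.univ (c ω) M fun i _ => hc ω i
      linarith [mul_nonneg hn'.le hD']
    · simpa using hgood ω h
  rw [one_div, inv_mul_le_iff₀ hn']
  refine hle.trans (mul_le_mul_of_nonneg_left ?_ hn'.le)
  linarith [mul_le_mul_of_nonneg_left hbad hM]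

lemma admissible_of_mem_RDag {S U V W : Type*} [Fintype S] [Fintype U] [Fintype V]
    [Nonempty W] {p : S × U × V → ℝ} (hp : IsPMF p) {Dbar : ℝ} (hDbar : 0 < Dbar) {d : S → W → ℝ}
    (hd : ∀ s w, 0 ≤ d s w ∧ d s w ≤ Dbar) {D : ℝ} {k : ℕ} {r : ℝ × ℝ} (hr : r ∈ RDag p d D k) :
    Admissible p d D r := by
  obtain ⟨hr₁, hr₂, q, ⟨⟨hq, hpq, hM, g, f, hg, hD⟩, hBC⟩, h₁, h₂⟩ := hr
  refine ⟨hr₁, hr₂, fun ε hε => ?_⟩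
  have hD0 : 0 ≤ D :=
    le_trans (Finset.sum_nonneg fun x _ => mul_nonneg (hq.1 x) (hd _ _).1) hD
  have hAU : MarkovChain q (fun x => x.1.1) (fun x => x.2.1) (fun x => x.2.2.1) :=
    hM.comp Prod.fst Prod.fst
  have hAV : MarkovChain q (fun x => x.1.1) (fun x => x.2.1) (fun x => x.2.2.2) :=
    hM.comp Prod.fst Prod.snd
  have hABU : MarkovChain q (fun x => (x.1.1, x.1.2.1)) (fun x => x.2.1) (fun x => x.2.2.1) :=
    hM.comp (fun a => (a.1, a.2.1)) Prod.fst
  have hACV : MarkovChain q (fun x => (x.1.1, x.1.2.2)) (fun x => x.2.1) (fun x => x.2.2.2) :=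
    hM.comp (fun a => (a.1, a.2.2)) Prod.snd
  have hIAU := condMI_nonneg hq (fun x => x.2.1) (fun x => x.1.1) (fun x => x.2.2.1)
  have hIAV := condMI_nonneg hq (fun x => x.2.1) (fun x => x.1.1) (fun x => x.2.2.2)
  have hIB := condMI_nonneg hq (fun x => x.2.1) (fun x => x.1.2.1) (fun x => (x.1.1, x.2.2.1))
  have hIC := condMI_nonneg hq (fun x => x.2.1) (fun x => x.1.2.2) (fun x => (x.1.1, x.2.2.2))
  rw [condMI_chain] at h₁
  rw [hAU.condMI_eq hq.1] at h₁ h₂ hIAU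
  rw [hAV.condMI_eq hq.1] at h₂ hIAV
  rw [hABU.condMI_eq_of_prod hq.1] at h₁ h₂ hIB
  rw [hACV.condMI_eq_of_prod hq.1] at h₂ hIC
  obtain ⟨N₁, hN₁⟩ := exists_bin_sizes (condEntRV_nonneg hq.1 _ _) (condEntRV_nonneg hq.1 _ _)
    (condEntRV_nonneg hq.1 _ _) (sub_nonneg.1 hIAU) (sub_nonneg.1 hIAV) (sub_nonneg.1 hIB)
    (sub_nonneg.1 hIC) h₁ h₂ hr₂ hε
  set η := ε / (16 * (1 + Dbar)) with hη
  have hη0 : 0 < η := by positivity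
  have hη1 : 8 * η * (1 + Dbar) = ε / 2 := by
    rw [hη]; field_simp; norm_num
  obtain ⟨N₂, hN₂⟩ := exists_block_code hq hpq hM hBC f hg d hD (δ := ε / 6) (by positivity) hη0
  set n := max (max N₁ N₂) 1 with hn
  have hn0 : 0 < n := by omega
  have hnN₁ : N₁ ≤ n := by omega
  have hnN₂ : N₂ ≤ n := by omega
  clear_value n
  obtain ⟨fA, fB, fC, mA, mB, mC, lA, t₁, t₂, b₁, b₂, b₃, b₄, b₅, b₆, b₇, ht, hL₁, hL₂⟩ :=
    hN₁ n hnN₁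
  obtain ⟨m, l, Du, Dv, hcode⟩ := hN₂ n hnN₂ (2 ^ fA) (2 ^ fB) (2 ^ fC) (2 ^ mA) (2 ^ mB)
    (2 ^ mC) (2 ^ lA) b₁ b₂ b₃ b₄ b₅ b₆ b₇
  obtain ⟨enc₁, enc₂, dec₁, dec₂, hdec⟩ := exists_message_split
    (μ := Fin (2 ^ mA) × Fin (2 ^ mB)) (ν := Fin (2 ^ lA) × Fin (2 ^ mC)) (t₁ := t₁) (t₂ := t₂)
    (by simpa [← pow_add] using Nat.pow_le_pow_right two_pos ht)
    (by simpa [← pow_add] using hL₁) hL₂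
  refine ⟨n, hn0, fun s => enc₁ (m s) (l s), fun s => enc₂ (l s), fun a u => Du (dec₁ a) u,
    fun a b v => Dv (dec₁ a) (dec₂ a b) v, ?_⟩
  simp only [(hdec _ _).1, (hdec _ _).2]
  have hP : IsPMF (iidPMF p n) := isPMF_iid hp
  have hD' : 0 ≤ D + ε / 6 := by positivity
  refine ⟨(average_expVal_le hP hn0 hD' hDbar.le (fun ω i => (hd _ _).2) hcode
    fun ω hω => (not_not.1 hω).2).trans ?_, (average_expVal_le hP hn0 hD' hDbar.le
    (fun ω i => (hd _ _).2) hcode fun ω hω => ?_).trans ?_, ?_⟩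
  · nlinarith
  · rw [← (not_not.1 hω).1]
    exact (not_not.1 hω).2
  · nlinarith
  · refine le_trans ?_ (hcode.trans (by nlinarith [mul_pos hη0 hDbar]))
    refine le_trans (le_of_eq ?_) (prob_mono hP.1 (E := fun ω =>
      Du (m fun i => (ω i).1) (fun i => (ω i).2.1) ≠
        Dv (m fun i => (ω i).1) (l fun i => (ω i).1) (fun i => (ω i).2.2))
      fun ω _ hne hgood => hne hgood.1)
    exact Finset.sum_congr rfl fun ω _ => by congr

/-- Theorem 1, inner bound: for D ∈ [D̲,D̄],
ℛ*(D) ⊆ ℛ†(D) ⊆ ℛ(D) (the D-admissible rate region). -/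
theorem stmt9 {S U V W : Type*} [Fintype S] [Fintype U] [Fintype V] [Fintype W] [Nonempty W]
    (p : S × U × V → ℝ) (hp : IsPMF p) (Dbar : ℝ) (hDbar : 0 < Dbar)
    (d : S → W → ℝ) (hd : ∀ s w, 0 ≤ d s w ∧ d s w ≤ Dbar)
    (D : ℝ) (hD1 : (⨅ φ : S → W, expVal p (fun x => d x.1 (φ x.1))) ≤ D) (hD2 : D ≤ Dbar) :
    (⋃ k : ℕ, RStar p d D k) ⊆ (⋃ k : ℕ, RDag p d D k) ∧
    (⋃ k : ℕ, RDag p d D k) ⊆ {r : ℝ × ℝ | Admissible p d D r} := by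
  refine ⟨Set.iUnion_mono fun k => RStar_subset_RDag p d D k, ?_⟩
  exact Set.iUnion_subset fun k r hr => admissible_of_mem_RDag hp hDbar hd hr

end CRR
end

section
/- (Pruning Method A, assertions (a)–(c).) Let (A₁,A₂,S,B₁,B₂) ~ p be finite-valued with Markov chain (A₁,A₂)–S–(B₁,B₂) and supp(S) = 𝒮. Let δ, η > 0 satisfy δ ≤ m_S(1−e^{−η}), and let ℰ ⊆ 𝒜₁×𝒜₂ satisfy Pr[(A₁,A₂)∈ℰ] ≥ 1−δ. Define p̃(a₁,a₂,s) := p(a₁,a₂,s)/Pr[(A₁,A₂)∈ℰ | S=s] for (a₁,a₂)∈ℰ and p̃(a₁,a₂,s) := 0 for (a₁,a₂)∉ℰ, and extend to p̃_{Ã₁Ã₂SB₁B₂} := p̃_{Ã₁Ã₂S}·p_{B₁B₂|S}. Then p̃_{Ã₁Ã₂SB₁B₂} is a valid pmf with Markov chain (Ã₁,Ã₂)–S–(B₁,B₂), and: (a) ‖p̃_{Ã₁Ã₂SB₁B₂} − p_{A₁A₂SB₁B₂}‖₁ ≤ 2δ/(m_S−δ) ≤ 2(e^η−1); (b) for every event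 ℱ ⊆ ℬ₁×ℬ₂ and every (a₁,a₂)∈ℰ, Pr[(B₁,B₂)∈ℱ | (Ã₁,Ã₂)=(a₁,a₂)] ≤ e^η · Pr[(B₁,B₂)∈ℱ | (A₁,A₂)=(a₁,a₂)]; (c) D_KL(p̃_{Ã₁Ã₂SB₁B₂} ‖ p_{A₁A₂SB₁B₂}) ≤ η. -/
open Finset

namespace CRR

open scoped Classical

variable {Ω α β γ : Type*}

section Pruning

variable {A₁ A₂ S B₁ B₂ : Type*} [Fintype A₁] [Fintype A₂] [Fintype S]
  [Fintype B₁] [Fintype B₂]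

/-- Marginal pmf of S. -/
noncomputable def margS (p : (A₁ × A₂) × S × (B₁ × B₂) → ℝ) (s : S) : ℝ :=
  push p (fun x => x.2.1) s

/-- Marginal pmf of ((A₁,A₂),S). -/
noncomputable def margAS (p : (A₁ × A₂) × S × (B₁ × B₂) → ℝ) (a : A₁ × A₂) (s : S) : ℝ :=
  push p (fun x => (x.1, x.2.1)) (a, s)

/-- Marginal pmf of (S,(B₁,B₂)). -/
noncomputable def margSB (p : (A₁ × A₂) × S × (B₁ × B₂) → ℝ) (sb : S × (B₁ × B₂)) : ℝ :=
  push p (fun x => x.2) sb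

/-- Marginal pmf of (A₁,A₂). -/
noncomputable def margA (p : (A₁ × A₂) × S × (B₁ × B₂) → ℝ) (a : A₁ × A₂) : ℝ :=
  push p (fun x => x.1) a

/-- m_S : the least (positive, under full support) probability mass of S. -/
noncomputable def mS (p : (A₁ × A₂) × S × (B₁ × B₂) → ℝ) : ℝ := ⨅ s, margS p s

/-- Pruning Method A: remove the pairs (a₁,a₂) outside E, renormalize conditionally on S=s,
and extend via the conditional law of (B₁,B₂) given S. -/
noncomputable def pruneA (p : (A₁ × A₂) × S × (B₁ × B₂) → ℝ) (E : Set (A₁ × A₂)) :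
    (A₁ × A₂) × S × (B₁ × B₂) → ℝ :=
  fun x =>
    if x.1 ∈ E then
      (margAS p x.1 x.2.1 * margS p x.2.1 / (∑ a, if a ∈ E then margAS p a x.2.1 else 0)) *
        (margSB p x.2 / margS p x.2.1)
    else 0

/-- The pruned edge set ℰ of Pruning Method B: the triples in the support of ((A₁,A₂),S)
whose conditional probability p_{S|A₁A₂}(s|a₁,a₂) exceeds δ. -/
def pruneBSet (p : (A₁ × A₂) × S × (B₁ × B₂) → ℝ) (δ : ℝ) : Set ((A₁ × A₂) × S) :=
  {as | 0 < margAS p as.1 as.2 ∧ δ < margAS p as.1 as.2 / margA p as.1}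

/-- Pruning Method B: keep only the edges in `pruneBSet`, renormalize conditionally on S=s,
and extend via the conditional law of (B₁,B₂) given S. -/
noncomputable def pruneB (p : (A₁ × A₂) × S × (B₁ × B₂) → ℝ) (δ : ℝ) :
    (A₁ × A₂) × S × (B₁ × B₂) → ℝ :=
  fun x =>
    if (x.1, x.2.1) ∈ pruneBSet p δ then
      (margAS p x.1 x.2.1 * margS p x.2.1 /
          (∑ a, if (a, x.2.1) ∈ pruneBSet p δ then margAS p a x.2.1 else 0)) *
        (margSB p x.2 / margS p x.2.1)
    else 0

/-- m_{B₁B₂|S} : the least positive conditional probability of (B₁,B₂) given S. -/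
noncomputable def mBS (p : (A₁ × A₂) × S × (B₁ × B₂) → ℝ) : ℝ :=
  sInf {x : ℝ | ∃ sb : S × (B₁ × B₂), 0 < margSB p sb ∧ x = margSB p sb / margS p sb.1}

/-- Shannon entropy in nats. -/
noncomputable def entN {α : Type*} [Fintype α] (q : α → ℝ) : ℝ := -∑ a, q a * Real.log (q a)

/-- Conditional Shannon entropy H(X|Y) in nats. -/
noncomputable def condEntN {Ω α β : Type*} [Fintype Ω] [Fintype α] [Fintype β]
    (p : Ω → ℝ) (X : Ω → α) (Y : Ω → β) : ℝ :=
  entN (push p (fun ω => (X ω, Y ω))) - entN (push p Y)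

end Pruning

section Pruning

variable {A₁ A₂ S B₁ B₂ : Type*} [Fintype A₁] [Fintype A₂] [Fintype S]
  [Fintype B₁] [Fintype B₂]

lemma margS_eq_sum (p : (A₁ × A₂) × S × (B₁ × B₂) → ℝ) (s : S) :
    margS p s = ∑ a, ∑ b, p (a, s, b) := by
  simp only [margS, push]
  rw [Fintype.sum_prod_type]
  refine Finset.sum_congr rfl fun a _ => ?_
  rw [Fintype.sum_prod_type, Finset.sum_comm]
  simp

lemma margAS_eq_sum (p : (A₁ × A₂) × S × (B₁ × B₂) → ℝ) (a : A₁ × A₂) (s : S) :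
    margAS p a s = ∑ b, p (a, s, b) := by
  simp only [margAS, push, Prod.mk.injEq, ite_and]
  rw [Fintype.sum_prod_type, Finset.sum_eq_single a (by intro c _ h; simp [h]) (by simp)]
  rw [Fintype.sum_prod_type, Finset.sum_comm]
  simp

lemma margSB_eq_sum (p : (A₁ × A₂) × S × (B₁ × B₂) → ℝ) (sb : S × (B₁ × B₂)) :
    margSB p sb = ∑ a, p (a, sb) := by
  simp only [margSB, push]
  rw [Fintype.sum_prod_type]
  refine Finset.sum_congr rfl fun a _ => ?_
  rw [Finset.sum_eq_single sb (by intro c _ h; simp [h]) (by simp)]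
  simp

lemma margA_eq_sum (p : (A₁ × A₂) × S × (B₁ × B₂) → ℝ) (a : A₁ × A₂) :
    margA p a = ∑ s, margAS p a s := by
  simp only [margA, push, margAS_eq_sum]
  rw [Fintype.sum_prod_type, Finset.sum_eq_single a (by intro c _ h; simp [h]) (by simp)]
  simp [Fintype.sum_prod_type (α₁ := S)]

lemma margS_eq_sum_margAS (p : (A₁ × A₂) × S × (B₁ × B₂) → ℝ) (s : S) :
    margS p s = ∑ a, margAS p a s := by
  simp only [margS_eq_sum, margAS_eq_sum]

lemma sum_eq_sum_margAS (p : (A₁ × A₂) × S × (B₁ × B₂) → ℝ) :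
    ∑ x, p x = ∑ s, ∑ a, margAS p a s := by
  rw [Fintype.sum_prod_type, Finset.sum_comm' (t' := univ) (s' := fun _ => univ) (by simp)]
  simp only [margAS_eq_sum]
  rw [Fintype.sum_prod_type]
  exact Finset.sum_congr rfl fun s _ => Finset.sum_comm

/-- The Markov chain condition `(A₁,A₂) – S – (B₁,B₂)` in terms of pointwise values. -/
lemma markovChain_iff (p : (A₁ × A₂) × S × (B₁ × B₂) → ℝ) :
    MarkovChain p (fun x => x.1) (fun x => x.2.1) (fun x => x.2.2) ↔
      ∀ a s b, p (a, s, b) * margS p s = margAS p a s * margSB p (s, b) := by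
  have h₁ (a s b) : push p (fun x => (x.1, x.2.1, x.2.2)) (a, s, b) = p (a, s, b) := by
    simp [push]
  have h₂ (b s) : push p (fun x => (x.2.2, x.2.1)) (b, s) = margSB p (s, b) := by
    simp only [push, margSB]
    refine Finset.sum_congr rfl fun x _ => ?_
    simp only [Prod.ext_iff, and_comm]
  simp only [MarkovChain, h₁, h₂]
  rfl

/-- A joint function that factors through `S` is a Markov chain `(A₁,A₂) – S – (B₁,B₂)`. -/
lemma markovChain_of_factor (u : A₁ × A₂ → S → ℝ) (v : S × (B₁ × B₂) → ℝ)
    (p : (A₁ × A₂) × S × (B₁ × B₂) → ℝ) (hp : ∀ a s b, p (a, s, b) = u a s * v (s, b)) :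
    MarkovChain p (fun x => x.1) (fun x => x.2.1) (fun x => x.2.2) := by
  rw [markovChain_iff]
  intro a s b
  rw [margS_eq_sum, margAS_eq_sum, margSB_eq_sum]
  simp only [hp, ← Finset.mul_sum, ← Finset.sum_mul]
  ring

/-- The joint probability that `(A₁,A₂) ∈ E` and `S = s`. -/
noncomputable def retainedMass (p : (A₁ × A₂) × S × (B₁ × B₂) → ℝ) (E : Set (A₁ × A₂))
    (s : S) : ℝ :=
  ∑ a, if a ∈ E then margAS p a s else 0

lemma pruneA_apply {p : (A₁ × A₂) × S × (B₁ × B₂) → ℝ}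
    (hmc : MarkovChain p (fun x => x.1) (fun x => x.2.1) (fun x => x.2.2))
    (hfull : ∀ s : S, 0 < margS p s) (E : Set (A₁ × A₂)) (x : (A₁ × A₂) × S × (B₁ × B₂)) :
    pruneA p E x =
      if x.1 ∈ E then margS p x.2.1 / retainedMass p E x.2.1 * p x else 0 := by
  obtain ⟨a, s, b⟩ := x
  have h := (markovChain_iff p).1 hmc a s b
  have hs := (hfull s).ne'
  have hx : p (a, s, b) = margAS p a s * margSB p (s, b) / margS p s := by
    rw [← h, mul_div_cancel_right₀ _ hs]
  simp only [pruneA, retainedMass]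
  split_ifs
  · rw [hx]; ring
  · rfl

lemma margAS_nonneg {p : (A₁ × A₂) × S × (B₁ × B₂) → ℝ} (hp : ∀ x, 0 ≤ p x)
    (a : A₁ × A₂) (s : S) : 0 ≤ margAS p a s := by
  rw [margAS_eq_sum]
  exact Finset.sum_nonneg fun _ _ => hp _

lemma retainedMass_le_margS {p : (A₁ × A₂) × S × (B₁ × B₂) → ℝ} (hp : ∀ x, 0 ≤ p x)
    (E : Set (A₁ × A₂)) (s : S) : retainedMass p E s ≤ margS p s := by
  rw [margS_eq_sum_margAS, retainedMass]
  refine Finset.sum_le_sum fun a _ => ?_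
  split_ifs
  · rfl
  · exact margAS_nonneg hp a s

lemma sum_retainedMass (p : (A₁ × A₂) × S × (B₁ × B₂) → ℝ) (E : Set (A₁ × A₂)) :
    ∑ s, retainedMass p E s = ∑ a, if a ∈ E then margA p a else 0 := by
  simp only [retainedMass]
  rw [Finset.sum_comm]
  refine Finset.sum_congr rfl fun a _ => ?_
  split_ifs
  · rw [margA_eq_sum]
  · simp

lemma sum_margS (p : (A₁ × A₂) × S × (B₁ × B₂) → ℝ) : ∑ s, margS p s = ∑ x, p x := by
  simp only [sum_eq_sum_margAS, margS_eq_sum_margAS]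

/-- Summing `f(S) · p` over the event `(A₁,A₂) ∈ E`. -/
lemma sum_ite_mem_mul (p : (A₁ × A₂) × S × (B₁ × B₂) → ℝ) (E : Set (A₁ × A₂)) (f : S → ℝ) :
    (∑ x, if x.1 ∈ E then f x.2.1 * p x else 0) = ∑ s, f s * retainedMass p E s := by
  rw [sum_eq_sum_margAS]
  refine Finset.sum_congr rfl fun s _ => ?_
  rw [retainedMass, Finset.mul_sum]
  refine Finset.sum_congr rfl fun a _ => ?_
  rw [margAS_eq_sum, margAS_eq_sum]
  split_ifs
  · rw [Finset.mul_sum]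
  · simp

lemma margS_sub_le_retainedMass {p : (A₁ × A₂) × S × (B₁ × B₂) → ℝ} (hp : IsPMF p)
    {δ : ℝ} {E : Set (A₁ × A₂)} (hE : 1 - δ ≤ ∑ a, (if a ∈ E then margA p a else 0)) (s : S) :
    margS p s - δ ≤ retainedMass p E s := by
  have h := Finset.single_le_sum (f := fun s => margS p s - retainedMass p E s)
    (fun t _ => sub_nonneg.2 (retainedMass_le_margS hp.1 E t)) (Finset.mem_univ s)
  rw [Finset.sum_sub_distrib, sum_margS, hp.2, sum_retainedMass] at h
  linarith

end Pruning

/-- Theorem 5, (a)–(c): properties of Pruning Method A. -/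
theorem stmt15 {A₁ A₂ S B₁ B₂ : Type*} [Fintype A₁] [Fintype A₂] [Fintype S] [Nonempty S]
    [Fintype B₁] [Fintype B₂]
    (p : (A₁ × A₂) × S × (B₁ × B₂) → ℝ) (hp : IsPMF p)
    (hmc : MarkovChain p (fun x => x.1) (fun x => x.2.1) (fun x => x.2.2))
    (hfull : ∀ s : S, 0 < margS p s)
    (δ η : ℝ) (hδ : 0 < δ) (hη : 0 < η) (hδη : δ ≤ mS p * (1 - Real.exp (-η)))
    (E : Set (A₁ × A₂))
    (hE : 1 - δ ≤ ∑ a, (if a ∈ E then margA p a else 0)) :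
    IsPMF (pruneA p E) ∧
    MarkovChain (pruneA p E) (fun x => x.1) (fun x => x.2.1) (fun x => x.2.2) ∧
    -- (a) variational distance bound
    ((∑ x, |pruneA p E x - p x|) ≤ 2 * δ / (mS p - δ) ∧
      2 * δ / (mS p - δ) ≤ 2 * (Real.exp η - 1)) ∧
    -- (b) conditional probabilities of (B₁,B₂)-events are inflated by at most e^η on E
    (∀ F : Set (B₁ × B₂), ∀ a ∈ E,
      (∑ x, (if x.1 = a ∧ x.2.2 ∈ F then pruneA p E x else 0)) / margA (pruneA p E) a ≤
        Real.exp η * ((∑ x, (if x.1 = a ∧ x.2.2 ∈ F then p x else 0)) / margA p a)) ∧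
    -- (c) KL-divergence bound
    (∑ x, pruneA p E x * Real.log (pruneA p E x / p x)) ≤ η := by
  have hm : ∀ s, mS p ≤ margS p s := fun s => ciInf_le (Set.finite_range _).bddBelow s
  obtain ⟨s₀, hs₀⟩ := exists_eq_ciInf_of_finite (f := margS p)
  have hm₀ : 0 < mS p := by rw [mS, ← hs₀]; exact hfull s₀
  have hexp : Real.exp (-η) * Real.exp η = 1 := by rw [← Real.exp_add]; simp
  have hmδ : mS p * Real.exp (-η) ≤ mS p - δ := by linarith
  have hmδ₀ : 0 < mS p - δ := (mul_pos hm₀ (Real.exp_pos _)).trans_le hmδ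
  have hm₁ : mS p ≤ 1 := by
    refine (hm s₀).trans ?_
    rw [← hp.2, ← sum_margS]
    exact Finset.single_le_sum (fun s _ => (hfull s).le) (Finset.mem_univ s₀)
  have hret := margS_sub_le_retainedMass hp hE
  have hret₀ (s : S) : 0 < retainedMass p E s :=
    hmδ₀.trans_le ((sub_le_sub_right (hm s) δ).trans (hret s))
  set c : S → ℝ := fun s => margS p s / retainedMass p E s with hc
  have hc₁ (s : S) : 1 ≤ c s := (one_le_div (hret₀ s)).2 (retainedMass_le_margS hp.1 E s)
  have hc₂ (s : S) : c s ≤ Real.exp η := by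
    rw [hc, div_le_iff₀ (hret₀ s)]
    have h : margS p s * Real.exp (-η) ≤ retainedMass p E s := by
      refine le_trans ?_ (hret s)
      have := mul_le_mul_of_nonneg_right (hm s)
        (sub_nonneg.2 (Real.exp_le_one_iff.2 (neg_nonpos.2 hη.le)))
      linarith
    calc margS p s = Real.exp η * (margS p s * Real.exp (-η)) := by
          linear_combination -margS p s * hexp
      _ ≤ _ := mul_le_mul_of_nonneg_left h (Real.exp_pos _).le
  have hcZ (s : S) : c s * retainedMass p E s = margS p s := div_mul_cancel₀ _ (hret₀ s).ne'
  have hq (x) : pruneA p E x = if x.1 ∈ E then c x.2.1 * p x else 0 :=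
    pruneA_apply hmc hfull E x
  have hq₀ (x) : 0 ≤ pruneA p E x := by
    rw [hq]
    split_ifs
    · exact mul_nonneg (zero_le_one.trans (hc₁ _)) (hp.1 x)
    · rfl
  have hq₁ : ∑ x, pruneA p E x = 1 := by
    simp only [hq]
    rw [sum_ite_mem_mul]
    simp only [hcZ]
    rw [sum_margS, hp.2]
  refine ⟨⟨hq₀, hq₁⟩, ?_, ⟨?_, ?_⟩, ?_, ?_⟩
  · refine markovChain_of_factor
      (fun a s => if a ∈ E then margAS p a s * margS p s / retainedMass p E s else 0)
      (fun sb => margSB p sb / margS p sb.1) _ fun a s b => ?_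
    simp only [pruneA, retainedMass, ite_mul, zero_mul]
  · have habs (x) : |pruneA p E x - p x| =
        2 * (if x.1 ∈ E then (c x.2.1 - 1) * p x else 0) - (pruneA p E x - p x) := by
      rw [hq]
      split_ifs
      · rw [abs_of_nonneg]
        · ring
        · nlinarith [mul_nonneg (sub_nonneg.2 (hc₁ x.2.1)) (hp.1 x)]
      · rw [zero_sub, abs_neg, abs_of_nonneg (hp.1 x)]
        ring
    have hsum : (∑ x, |pruneA p E x - p x|) ≤ 2 * δ := by
      simp only [habs]
      rw [Finset.sum_sub_distrib, Finset.sum_sub_distrib, ← Finset.mul_sum, hq₁, hp.2,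
        sum_ite_mem_mul p E (fun s => c s - 1)]
      simp only [sub_mul, hcZ, one_mul]
      rw [Finset.sum_sub_distrib, sum_margS, hp.2, sum_retainedMass]
      linarith
    refine hsum.trans ?_
    rw [le_div_iff₀ hmδ₀]
    nlinarith
  · rw [div_le_iff₀ hmδ₀]
    have h := mul_le_mul_of_nonneg_right hmδ (Real.exp_pos η).le
    rw [mul_assoc, hexp] at h
    linarith
  · intro F a ha
    have hnum : (∑ x, (if x.1 = a ∧ x.2.2 ∈ F then pruneA p E x else 0)) ≤
        Real.exp η * ∑ x, (if x.1 = a ∧ x.2.2 ∈ F then p x else 0) := by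
      rw [Finset.mul_sum]
      refine Finset.sum_le_sum fun x _ => ?_
      split_ifs with h
      · rw [hq, if_pos (h.1 ▸ ha)]
        exact mul_le_mul_of_nonneg_right (hc₂ _) (hp.1 x)
      · simp
    have hnum₀ : 0 ≤ ∑ x, (if x.1 = a ∧ x.2.2 ∈ F then pruneA p E x else 0) := by
      refine Finset.sum_nonneg fun x _ => ?_
      split_ifs
      · exact hq₀ x
      · rfl
    have hden : margA p a ≤ margA (pruneA p E) a := by
      refine Finset.sum_le_sum fun x _ => ?_
      split_ifs with h
      · rw [hq, if_pos ((show x.1 = a from h) ▸ ha)]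
        exact le_mul_of_one_le_left (hp.1 x) (hc₁ _)
      · rfl
    have hA₀ : 0 ≤ margA p a := by
      rw [margA_eq_sum]
      exact Finset.sum_nonneg fun s _ => margAS_nonneg hp.1 a s
    rcases hA₀.eq_or_lt with h | h
    · have hz : margA (pruneA p E) a = 0 := by
        refine le_antisymm ?_ (h.le.trans hden)
        have : margA (pruneA p E) a ≤ Real.exp η * margA p a := by
          rw [margA, margA, push, push, Finset.mul_sum]
          refine Finset.sum_le_sum fun x _ => ?_
          split_ifs with hx
          · rw [hq, if_pos (hx ▸ ha)]
            exact mul_le_mul_of_nonneg_right (hc₂ _) (hp.1 x)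
          · simp
        simpa [← h] using this
      rw [hz, ← h]
      simp
    · rw [← mul_div_assoc]
      exact div_le_div₀ (hnum₀.trans hnum) hnum h hden
  · calc (∑ x, pruneA p E x * Real.log (pruneA p E x / p x))
        ≤ ∑ x, pruneA p E x * η := by
          refine Finset.sum_le_sum fun x _ => ?_
          rcases (hq₀ x).eq_or_lt with h | h
          · simp [← h]
          refine mul_le_mul_of_nonneg_left ?_ h.le
          have hE' : x.1 ∈ E := by
            by_contra hx
            simp [hq, hx] at h
          have hx := hq x
          rw [if_pos hE'] at hx
          have hpx : p x ≠ 0 := by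
            intro h₀
            simp [hx, h₀] at h
          rw [hx, mul_div_cancel_right₀ _ hpx, Real.log_le_iff_le_exp (by linarith [hc₁ x.2.1])]
          exact hc₂ _
      _ = η := by rw [← Finset.sum_mul, hq₁, one_mul]

end CRR
end

section
/- Let X ~ p and Y ~ q be independent random variables taking values in finite sets 𝒳 and 𝒴, let 𝒵 be a finite set, and let f: 𝒳 → 𝒵 and g: 𝒴 → 𝒵 be functions satisfying Pr[f(X) ≠ g(Y)] ≤ δ for some δ < 1/25. Then there exists z* ∈ 𝒵 such that Pr[f(X) = z*] ≥ (1 + √(1 − δ − √δ))/2 and Pr[g(Y) = z*] ≥ (1 + √(1 − δ − √δ))/2. -/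
open Finset

namespace CRR

open scoped Classical

variable {Ω α β γ : Type*}

theorem push_add_push_le_one [Fintype Ω] {p : Ω → ℝ} (hp : IsPMF p) (X : Ω → α) {a b : α}
    (hab : a ≠ b) : push p X a + push p X b ≤ 1 := by
  rw [← hp.2, push, push, ← Finset.sum_add_distrib]
  refine Finset.sum_le_sum fun ω _ => ?_
  have h0 := hp.1 ω
  split_ifs with h1 h2 <;> first | exact absurd (h1.symm.trans h2) hab | linarith

/-- For independent variables, `Pr[f(X) ≠ g(Y)] = 1 - E[Pr[g(Y) = f(X) | X]]`. -/
theorem sum_ite_ne_eq [Fintype α] [Fintype β] {p : α → ℝ} {q : β → ℝ} (hp : IsPMF p)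
    (hq : IsPMF q) (f : α → γ) (g : β → γ) :
    ∑ x, ∑ y, (if f x ≠ g y then p x * q y else 0) = 1 - ∑ x, p x * push q g (f x) := by
  rw [← hp.2, ← Finset.sum_sub_distrib]
  refine Finset.sum_congr rfl fun x _ => ?_
  have hx : p x - p x * push q g (f x) = p x * (∑ y, q y - push q g (f x)) := by rw [hq.2]; ring
  rw [hx, push, ← Finset.sum_sub_distrib, Finset.mul_sum]
  refine Finset.sum_congr rfl fun y _ => ?_
  by_cases hy : f x = g y
  · simp [hy]
  · simp [hy, Ne.symm hy]

/-- If `f(X)` and `g(Y)` are independent and differ with probability at most `δ < 1/2`, then some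
value is taken by each of them with probability at least `1 - δ`. -/
theorem exists_one_sub_le_push [Fintype α] [Fintype β] [Finite γ] {p : α → ℝ} {q : β → ℝ}
    (hp : IsPMF p) (hq : IsPMF q) (f : α → γ) (g : β → γ) {δ : ℝ} (hδ : δ < 1 / 2)
    (h : ∑ x, ∑ y, (if f x ≠ g y then p x * q y else 0) ≤ δ) :
    ∃ z, 1 - δ ≤ push p f z ∧ 1 - δ ≤ push q g z := by
  rw [sum_ite_ne_eq hp hq] at h
  have : Nonempty α := by
    by_contra hα
    rw [not_nonempty_iff] at hα
    simpa using hp.2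
  have : Nonempty γ := this.map f
  obtain ⟨z, hz⟩ := Finite.exists_max (push q g)
  have hb : ∑ x, p x * push q g (f x) ≤ push q g z := by
    calc ∑ x, p x * push q g (f x) ≤ ∑ x, p x * push q g z :=
          Finset.sum_le_sum fun x _ => mul_le_mul_of_nonneg_left (hz _) (hp.1 x)
      _ = push q g z := by rw [← Finset.sum_mul, hp.2, one_mul]
  have hab : ∑ x, p x * push q g (f x) ≤
      push p f z * push q g z + (1 - push p f z) * (1 - push q g z) := by
    calc ∑ x, p x * push q g (f x)
        ≤ ∑ x, ((if f x = z then p x else 0) * push q g z +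
            (p x - if f x = z then p x else 0) * (1 - push q g z)) := by
          refine Finset.sum_le_sum fun x _ => ?_
          by_cases hx : f x = z
          · simp [hx]
          · have := mul_le_mul_of_nonneg_left (push_add_push_le_one hq g hx) (hp.1 x)
            simp only [hx, if_false]
            linarith
      _ = push p f z * push q g z + (1 - push p f z) * (1 - push q g z) := by
          rw [Finset.sum_add_distrib, ← Finset.sum_mul, ← Finset.sum_mul, Finset.sum_sub_distrib,
            hp.2]
          rfl
  have hb1 : push q g z ≤ 1 := by
    rw [← hq.2]
    refine Finset.sum_le_sum fun y _ => ?_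
    have := hq.1 y
    split_ifs <;> linarith
  refine ⟨z, ?_, by linarith⟩
  have ha : 1 / 2 ≤ push p f z := by
    by_contra! ha
    nlinarith
  nlinarith

theorem one_add_sqrt_div_two_le {δ : ℝ} (h0 : 0 ≤ δ) (hδ : δ < 1 / 25) :
    (1 + √(1 - δ - √δ)) / 2 ≤ 1 - δ := by
  have hs : √δ ≤ 1 / 5 := Real.sqrt_le_iff.2 ⟨by norm_num, by linarith⟩
  have h5 : 5 * δ ≤ √δ := by nlinarith [Real.sq_sqrt h0, Real.sqrt_nonneg δ]
  have : √(1 - δ - √δ) ≤ 1 - 2 * δ := Real.sqrt_le_iff.2 ⟨by linarith, by nlinarith⟩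
  linarith

/-- Lemma on functions of independent random variables: if
Pr[f(X) ≠ g(Y)] ≤ δ < 1/25 for independent X ~ p and Y ~ q, then some z* carries
probability at least (1+√(1−δ−√δ))/2 under both f(X) and g(Y). -/
theorem stmt19 {X Y Z : Type*} [Fintype X] [Fintype Y] [Fintype Z]
    (p : X → ℝ) (q : Y → ℝ) (hp : IsPMF p) (hq : IsPMF q)
    (f : X → Z) (g : Y → Z) (δ : ℝ) (hδ : δ < 1 / 25)
    (h : ∑ x, ∑ y, (if f x ≠ g y then p x * q y else 0) ≤ δ) :
    ∃ z : Z,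
      (1 + Real.sqrt (1 - δ - Real.sqrt δ)) / 2 ≤ ∑ x, (if f x = z then p x else 0) ∧
      (1 + Real.sqrt (1 - δ - Real.sqrt δ)) / 2 ≤ ∑ y, (if g y = z then q y else 0) := by
  have h0 : 0 ≤ δ := h.trans' <| Finset.sum_nonneg fun x _ => Finset.sum_nonneg fun y _ => by
    split_ifs
    exacts [mul_nonneg (hp.1 x) (hq.1 y), le_rfl]
  obtain ⟨z, hpz, hqz⟩ := exists_one_sub_le_push hp hq f g (by linarith) h
  have hle := one_add_sqrt_div_two_le h0 hδ
  exact ⟨z, hle.trans hpz, hle.trans hqz⟩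

end CRR
end
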